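/- arXiv:1505.06332 — 3 statements merged into one kernel-verified Lean document; each statement's English description precedes it below -/
import Mathlib

section
/- If a point x has a periodic orbit of period n under the outer billiard map T about a convex polygon, then there exists ε > 0 such that every point in the punctured ε-ball around x is periodic with period n if n is even, and period 2n if n is odd. -/
/-- Let `T` be the outer billiard map about a convex polygon: on its domain of definition
`D`, `T` is locally a point reflection through a vertex (the vertex being locally constant).
If `x` is periodic with (minimal) period `n`, then there is `ε > 0` such that every point of
the punctured `ε`-ball around `x` is periodic with minimal period `n` if `n` is even, and
with minimal period `2n` if `n` is odd. -/
theorem periodic_point_punctured_neighborhood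
    (T : ℝ × ℝ → ℝ × ℝ) (D : Set (ℝ × ℝ))
    (hloc : ∀ y ∈ D, ∃ ε > (0 : ℝ), ∃ v : ℝ × ℝ,
      ∀ z ∈ Metric.ball y ε, T z = (2 : ℝ) • v - z)
    (x : ℝ × ℝ) (hxD : ∀ k : ℕ, T^[k] x ∈ D)
    (n : ℕ) (hn : 0 < n) (hper : T^[n] x = x)
    (hmin : ∀ m : ℕ, 0 < m → m < n → T^[m] x ≠ x) :
    ∃ ε > (0 : ℝ), ∀ y ∈ Metric.ball x ε, y ≠ x →
      (Even n → T^[n] y = y ∧ ∀ m : ℕ, 0 < m → m < n → T^[m] y ≠ y) ∧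
      (Odd n → T^[2 * n] y = y ∧ ∀ m : ℕ, 0 < m → m < 2 * n → T^[m] y ≠ y) := by
  have key : ∀ k : ℕ, ∀ᶠ y in nhds x, T^[k] y = T^[k] x + (-1 : ℝ) ^ k • (y - x) := by
    intro k
    induction k with
    | zero => simp
    | succ k ih =>
      obtain ⟨ε, hε, v, hv⟩ := hloc _ (hxD k)
      have ht : Filter.Tendsto (fun y => T^[k] x + (-1 : ℝ) ^ k • (y - x)) (nhds x)
          (nhds (T^[k] x)) := by
        have hc : Continuous (fun y => T^[k] x + (-1 : ℝ) ^ k • (y - x)) := by fun_prop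
        simpa using hc.tendsto x
      filter_upwards [ih, ht.eventually (Metric.ball_mem_nhds _ hε)] with y hy hb
      rw [Function.iterate_succ_apply', Function.iterate_succ_apply',
        hv _ (Metric.mem_ball_self hε), hy, hv _ hb, pow_succ]
      module
  have hne : ∀ m : ℕ, T^[m] x ≠ x → ∀ᶠ y in nhds x, T^[m] y ≠ y := by
    intro m hm
    have hc : Continuous (fun y => T^[m] x + (-1 : ℝ) ^ m • (y - x)) := by fun_prop
    have ht := (isOpen_ne_fun hc continuous_id).mem_nhds (x := x) (by simpa using hm)
    filter_upwards [key m, ht] with y hy h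
    rw [hy]
    exact h
  have hall : ∀ᶠ y in nhds x, ∀ m ∈ Finset.range (2 * n), T^[m] x ≠ x → T^[m] y ≠ y := by
    rw [Filter.eventually_all_finset]
    intro m _
    by_cases h : T^[m] x = x
    · simp [h]
    · filter_upwards [hne m h] with y hy _ using hy
  have hper2 : T^[2 * n] x = x := by
    rw [two_mul, Function.iterate_add_apply, hper, hper]
  obtain ⟨ε, hε, H⟩ := Metric.eventually_nhds_iff_ball.1 ((key n).and ((key (2 * n)).and hall))
  refine ⟨ε, hε, fun y hy hyx => ?_⟩
  obtain ⟨h1, h2, h3⟩ := H y hy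
  refine ⟨fun he => ⟨?_, fun m hm hmn => ?_⟩, fun ho => ⟨?_, fun m hm hmn => ?_⟩⟩
  · rw [h1, hper, he.neg_one_pow]; module
  · exact h3 m (Finset.mem_range.2 (by omega)) (hmin m hm hmn)
  · rw [h2, hper2, (even_two_mul n).neg_one_pow]; module
  · rcases lt_trichotomy m n with h | h | h
    · exact h3 m (Finset.mem_range.2 hmn) (hmin m hm h)
    · subst h
      rw [h1, hper, ho.neg_one_pow]
      intro h
      apply hyx
      have h4 : (2 : ℝ) • (y - x) = 0 := by
        have : (2 : ℝ) • (y - x) = y - (x + (-1 : ℝ) • (y - x)) := by module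
        rw [this, h, sub_self]
      exact sub_eq_zero.1 ((smul_eq_zero.1 h4).resolve_left two_ne_zero)
    · refine h3 m (Finset.mem_range.2 hmn) ?_
      have := hmin (m - n) (by omega) (by omega)
      rwa [show m = (m - n) + n by omega, Function.iterate_add_apply, hper]
end

section
/- For the outer billiard map about the unit square, every point with periodic orbit has period divisible by 4. Specifically, each point in the interior of a unit lattice cell at Manhattan distance d ≥ 1 from the square is periodic with period exactly 4d. -/
/-- The planar cross product of two vectors in `ℝ × ℝ`. -/
def cross (u v : ℝ × ℝ) : ℝ := u.1 * v.2 - u.2 * v.1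

/-- The unit square table `[0,1]²`. -/
def unitSquare : Set (ℝ × ℝ) := Set.Icc (0 : ℝ) 1 ×ˢ Set.Icc (0 : ℝ) 1

/-- The vertices of the unit square. -/
def squareVertices : Set (ℝ × ℝ) := {(0, 0), (1, 0), (1, 1), (0, 1)}

/-- `p` is the vertex of the unit square at which the right tangent line from `x` touches
the square (strict tangency).  The outer billiard map about the square is defined exactly
at points admitting such a vertex and sends `x` to `2 • p - x`. -/
def IsVertexTangency (x p : ℝ × ℝ) : Prop :=
  p ∈ squareVertices ∧ ∀ q ∈ unitSquare, q ≠ p → 0 < cross (p - x) (q - x)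

/-- The open unit lattice cell `(m, m+1) × (k, k+1)`; the cell `(0,0)` is the interior of
the table itself, and for `(m, k) ≠ (0, 0)` the cell lies outside the table, at Manhattan
distance `|m| + |k|` (in cell units) from the square. -/
def cell (m k : ℤ) : Set (ℝ × ℝ) :=
  Set.Ioo (m : ℝ) (m + 1) ×ˢ Set.Ioo (k : ℝ) (k + 1)

/-- Rotation by a quarter turn about the centre of the square. -/
def rho (x : ℝ × ℝ) : ℝ × ℝ := (1 - x.2, x.1)

lemma rho_four (x : ℝ × ℝ) : rho (rho (rho (rho x))) = x := by
  ext <;> simp [rho]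

lemma rho_iter_add_four (i : ℕ) (x : ℝ × ℝ) : rho^[i + 4] x = rho^[i] x := by
  rw [Function.iterate_add_apply]
  congr 1
  exact rho_four x

lemma rho_iter_mul (i n : ℕ) (x : ℝ × ℝ) : rho^[i + 4 * n] x = rho^[i] x := by
  induction n with
  | zero => rfl
  | succ n ih => rw [show i + 4 * (n + 1) = (i + 4 * n) + 4 by ring, rho_iter_add_four, ih]

lemma rho_iter_mod (i : ℕ) (x : ℝ × ℝ) : rho^[i] x = rho^[i % 4] x := by
  conv_lhs => rw [← Nat.mod_add_div i 4]
  exact rho_iter_mul _ _ _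

lemma rho_tangency {x p : ℝ × ℝ} (h : IsVertexTangency x p) :
    IsVertexTangency (rho x) (rho p) := by
  obtain ⟨h1, h2⟩ := h
  refine ⟨?_, ?_⟩
  · simp only [squareVertices, Set.mem_insert_iff, Set.mem_singleton_iff] at h1 ⊢
    rcases h1 with rfl | rfl | rfl | rfl <;> simp [rho]
  · intro q hq hqp
    have hq' : ((q.2, 1 - q.1) : ℝ × ℝ) ∈ unitSquare := by
      simp only [unitSquare, Set.mem_prod, Set.mem_Icc] at hq ⊢
      obtain ⟨⟨a, b⟩, c, d⟩ := hq
      refine ⟨⟨c, d⟩, ?_, ?_⟩ <;> linarith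
    have := h2 _ hq' (by
      rintro rfl
      apply hqp
      ext <;> simp [rho])
    simp only [cross, rho, Prod.fst_sub, Prod.snd_sub] at this ⊢
    nlinarith

lemma rho_iter_tangency {x p : ℝ × ℝ} (h : IsVertexTangency x p) (i : ℕ) :
    IsVertexTangency (rho^[i] x) (rho^[i] p) := by
  induction i with
  | zero => exact h
  | succ i ih =>
    rw [Function.iterate_succ_apply', Function.iterate_succ_apply']
    exact rho_tangency ih

lemma tangency_base {a b : ℝ} (ha : 1 < a) (hb : b < 1) :
    IsVertexTangency (a, b) (1, 1) := by
  refine ⟨by simp [squareVertices], ?_⟩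
  rintro ⟨s, t⟩ hq hne
  simp only [unitSquare, Set.mem_prod, Set.mem_Icc] at hq
  obtain ⟨⟨h1, h2⟩, h3, h4⟩ := hq
  simp only [cross, Prod.fst_sub, Prod.snd_sub]
  have e : (1 - a) * (t - b) - (1 - b) * (s - a) = (a - 1) * (1 - t) + (1 - b) * (1 - s) := by ring
  rw [e]
  rcases lt_or_eq_of_le h2 with h | h
  · have := mul_pos (sub_pos.2 hb) (sub_pos.2 h)
    have := mul_nonneg (sub_pos.2 ha).le (sub_nonneg.2 h4)
    linarith
  · rcases lt_or_eq_of_le h4 with h' | h'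
    · have := mul_pos (sub_pos.2 ha) (sub_pos.2 h')
      have := mul_nonneg (sub_pos.2 hb).le (sub_nonneg.2 h2)
      linarith
    · exact absurd (Prod.ext h h') hne

lemma reflect_iter (i : ℕ) (p x : ℝ × ℝ) :
    (2 : ℝ) • rho^[i] p - rho^[i] x = rho^[i] ((2 : ℝ) • p - x) := by
  induction i with
  | zero => rfl
  | succ i ih =>
    rw [Function.iterate_succ_apply', Function.iterate_succ_apply',
      Function.iterate_succ_apply', ← ih]
    ext <;> simp [rho]
    ring

/-- Every point with a tangency vertex lies in a rotated copy of the quadrant. -/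
lemma tangency_region {x p : ℝ × ℝ} (h : IsVertexTangency x p) :
    ∃ (i : ℕ) (a b : ℝ), 1 < a ∧ b < 1 ∧ x = rho^[i] (a, b) := by
  obtain ⟨h1, h2⟩ := h
  obtain ⟨a, b⟩ := x
  have q00 := h2 (0, 0) (by simp [unitSquare])
  have q10 := h2 (1, 0) (by simp [unitSquare])
  have q11 := h2 (1, 1) (by simp [unitSquare])
  have q01 := h2 (0, 1) (by simp [unitSquare])
  simp only [squareVertices, Set.mem_insert_iff, Set.mem_singleton_iff] at h1
  rcases h1 with rfl | rfl | rfl | rfl <;>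
    simp [cross] at q00 q10 q11 q01
  · exact ⟨2, 1 - a, 1 - b, by linarith, by linarith, by ext <;> simp [rho]⟩
  · exact ⟨3, 1 - b, a, by linarith, by linarith, by ext <;> simp [rho]⟩
  · exact ⟨0, a, b, by linarith, by linarith, by ext <;> simp⟩
  · exact ⟨1, b, 1 - a, by linarith, by linarith, by ext <;> simp [rho]⟩

lemma region_inj {i j : ℕ} {a b c d : ℝ} (ha : 1 < a) (hb : b < 1) (hc : 1 < c) (hd : d < 1)
    (h : rho^[i] (a, b) = rho^[j] (c, d)) : i % 4 = j % 4 ∧ a = c ∧ b = d := by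
  rw [rho_iter_mod i, rho_iter_mod j] at h
  have hi : i % 4 < 4 := Nat.mod_lt _ (by norm_num)
  have hj : j % 4 < 4 := Nat.mod_lt _ (by norm_num)
  generalize i % 4 = i at *
  generalize j % 4 = j at *
  interval_cases i <;> interval_cases j <;>
    simp only [rho, Function.iterate_succ, Function.iterate_zero, Function.comp_apply, id,
      Prod.mk.injEq] at h <;> obtain ⟨h1, h2⟩ := h <;>
    first
    | (exfalso; linarith)
    | exact ⟨rfl, by linarith, by linarith⟩

lemma boundary_not {i j : ℕ} {t c d : ℝ} (ht : 1 < t) (hc : 1 < c) (hd : d < 1)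
    (h : rho^[i] (0, t) = rho^[j] (c, d)) : False := by
  rw [rho_iter_mod i, rho_iter_mod j] at h
  have hi : i % 4 < 4 := Nat.mod_lt _ (by norm_num)
  have hj : j % 4 < 4 := Nat.mod_lt _ (by norm_num)
  generalize i % 4 = i at *
  generalize j % 4 = j at *
  interval_cases i <;> interval_cases j <;>
    simp only [rho, Function.iterate_succ, Function.iterate_zero, Function.comp_apply, id,
      Prod.mk.injEq] at h <;> obtain ⟨h1, h2⟩ := h <;> linarith

section dynamics

lemma step0 {T : ℝ × ℝ → ℝ × ℝ}
    (hT : ∀ x p : ℝ × ℝ, IsVertexTangency x p → T x = (2 : ℝ) • p - x)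
    (i : ℕ) {a b : ℝ} (ha : 1 < a) (hb : b < 1) :
    T (rho^[i] (a, b)) = rho^[i] (2 - a, 2 - b) := by
  rw [hT _ _ (rho_iter_tangency (tangency_base ha hb) i), reflect_iter]
  congr 1
  ext <;> simp

lemma step1 {T : ℝ × ℝ → ℝ × ℝ}
    (hT : ∀ x p : ℝ × ℝ, IsVertexTangency x p → T x = (2 : ℝ) • p - x)
    (i : ℕ) {a b : ℝ} (ha : 1 < a) (hb : b < 1) :
    T (rho^[i] (a, b)) = rho^[i + 1] (2 - b, a - 1) := by
  rw [step0 hT i ha hb, Function.iterate_succ_apply]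
  congr 1
  ext <;> simp [rho]
  ring

lemma step2 {T : ℝ × ℝ → ℝ × ℝ}
    (hT : ∀ x p : ℝ × ℝ, IsVertexTangency x p → T x = (2 : ℝ) • p - x)
    (i : ℕ) {a b : ℝ} (ha : 1 < a) (hb : b < 1) :
    T (rho^[i] (a, b)) = rho^[i + 2] (a - 1, b - 1) := by
  rw [step0 hT i ha hb, Function.iterate_add_apply]
  congr 1
  ext <;> simp [rho] <;> ring

lemma steps {T : ℝ × ℝ → ℝ × ℝ}
    (hT : ∀ x p : ℝ × ℝ, IsVertexTangency x p → T x = (2 : ℝ) • p - x)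
    (i j : ℕ) {a b : ℝ} (ha : (j : ℝ) < a) (hb : b < 1) :
    T^[j] (rho^[i] (a, b)) = rho^[i + 2 * j] (a - j, b - j) := by
  induction j with
  | zero => simp
  | succ j ih =>
    push_cast at ha
    have hj : (0 : ℝ) ≤ j := Nat.cast_nonneg j
    rw [Function.iterate_succ_apply', ih (by linarith),
      step2 hT _ (by linarith) (by linarith)]
    push_cast
    rw [show i + 2 * (j + 1) = i + 2 * j + 2 by ring]
    congr 2 <;> ring

/-- One full pass along an arm. -/
lemma pass {T : ℝ × ℝ → ℝ × ℝ}
    (hT : ∀ x p : ℝ × ℝ, IsVertexTangency x p → T x = (2 : ℝ) • p - x)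
    (i e : ℕ) {a b : ℝ} (ha : (e : ℝ) + 1 < a) (hb : b < 1) :
    T^[e + 1] (rho^[i] (a, b)) = rho^[i + 2 * e + 1] (e + 2 - b, a - e - 1) := by
  have hj : (0 : ℝ) ≤ e := Nat.cast_nonneg e
  rw [Function.iterate_succ_apply', steps hT _ _ (by linarith) hb,
    step1 hT _ (by linarith) (by linarith)]
  congr 2
  ring

lemma passes {T : ℝ × ℝ → ℝ × ℝ}
    (hT : ∀ x p : ℝ × ℝ, IsVertexTangency x p → T x = (2 : ℝ) • p - x)
    (e q i : ℕ) {a b : ℝ} (ha : (e : ℝ) + 1 < a) (ha' : a < e + 2)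
    (hb : 0 < b) (hb' : b < 1) :
    ∃ a' b' : ℝ, (e : ℝ) + 1 < a' ∧ a' < e + 2 ∧ 0 < b' ∧ b' < 1 ∧
      T^[(e + 1) * q] (rho^[i] (a, b)) = rho^[i + (2 * e + 1) * q] (a', b') := by
  induction q with
  | zero => exact ⟨a, b, ha, ha', hb, hb', by simp⟩
  | succ q ih =>
    obtain ⟨a', b', h1, h2, h3, h4, h5⟩ := ih
    refine ⟨e + 2 - b', a' - e - 1, by linarith, by linarith, by linarith, by linarith, ?_⟩
    rw [show (e + 1) * (q + 1) = (e + 1) + (e + 1) * q by ring, Function.iterate_add_apply, h5,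
      pass hT _ _ h1 h4]
    congr 1
    ring

lemma good_period {T : ℝ × ℝ → ℝ × ℝ}
    (hT : ∀ x p : ℝ × ℝ, IsVertexTangency x p → T x = (2 : ℝ) • p - x)
    (e i : ℕ) {a b : ℝ} (ha : (e : ℝ) + 1 < a) (ha' : a < e + 2)
    (hb : 0 < b) (hb' : b < 1) :
    T^[4 * (e + 1)] (rho^[i] (a, b)) = rho^[i] (a, b) := by
  rw [show 4 * (e + 1) = (e + 1) + ((e + 1) + ((e + 1) + (e + 1))) by ring]
  simp only [Function.iterate_add_apply T (e + 1)]
  rw [pass hT _ _ ha hb', pass hT _ _ (by linarith) (by linarith),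
    pass hT _ _ (by linarith) (by linarith), pass hT _ _ (by linarith) (by linarith)]
  rw [← rho_iter_mul i (2 * e + 1) (a, b)]
  congr 1
  · ring
  · ext <;> simp <;> ring

lemma good_min {T : ℝ × ℝ → ℝ × ℝ}
    (hT : ∀ x p : ℝ × ℝ, IsVertexTangency x p → T x = (2 : ℝ) • p - x)
    (e i s : ℕ) {a b : ℝ} (ha : (e : ℝ) + 1 < a) (ha' : a < e + 2)
    (hb : 0 < b) (hb' : b < 1) (hs : 0 < s) (hs' : s < 4 * (e + 1))
    (h : T^[s] (rho^[i] (a, b)) = rho^[i] (a, b)) : False := by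
  obtain ⟨a', b', h1, h2, h3, h4, h5⟩ := passes hT e (s / (e + 1)) i ha ha' hb hb'
  have hr : s % (e + 1) < e + 1 := Nat.mod_lt _ (by omega)
  have hq : s / (e + 1) < 4 := Nat.div_lt_of_lt_mul (by linarith)
  have hsplit := Nat.mod_add_div s (e + 1)
  generalize s % (e + 1) = r at *
  generalize s / (e + 1) = q at *
  have hr' : (r : ℝ) ≤ e := by exact_mod_cast Nat.lt_succ_iff.1 hr
  have hr0 : (0 : ℝ) ≤ r := Nat.cast_nonneg r
  rw [← hsplit, Function.iterate_add_apply, h5, steps hT _ _ (by linarith) h4] at h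
  obtain ⟨g1, g2, g3⟩ := region_inj (by linarith) (by linarith)
    (by linarith [(Nat.cast_nonneg e : (0 : ℝ) ≤ e)]) hb' h
  have : (r : ℝ) < 1 := by linarith
  have hr1 : r = 0 := by
    have : r < 1 := by exact_mod_cast this
    omega
  subst hr1
  interval_cases q <;> omega

lemma region_main {T : ℝ × ℝ → ℝ × ℝ}
    (hT : ∀ x p : ℝ × ℝ, IsVertexTangency x p → T x = (2 : ℝ) • p - x)
    (i : ℕ) (e j : ℕ) (hj : j ≤ e) {a b : ℝ} (ha : (e : ℝ) - j + 1 < a)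
    (ha' : a < e - j + 2) (hb : -(j : ℝ) < b) (hb' : b < 1 - j) :
    T^[4 * (e + 1)] (rho^[i] (a, b)) = rho^[i] (a, b) ∧
      ∀ s : ℕ, 0 < s → s < 4 * (e + 1) → T^[s] (rho^[i] (a, b)) ≠ rho^[i] (a, b) := by
  have hje : (j : ℝ) ≤ e := by exact_mod_cast hj
  have ea : (e : ℝ) + 1 < a + j := by linarith
  have ea' : a + j < (e : ℝ) + 2 := by linarith
  have eb : 0 < b + j := by linarith
  have eb' : b + j < 1 := by linarith
  have key : T^[j] (rho^[i + 2 * j] (a + j, b + j)) = rho^[i] (a, b) := by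
    rw [steps hT _ _ (by linarith) eb', ← rho_iter_mul i j]
    congr 1
    · ring
    · ext <;> simp
  have per := good_period hT e (i + 2 * j) ea ea' eb eb'
  refine ⟨?_, ?_⟩
  · rw [← key, ← Function.iterate_add_apply, Nat.add_comm, Function.iterate_add_apply, per]
  · intro s hs hs' h
    apply good_min hT e (i + 2 * j) s ea ea' eb eb' hs hs'
    have back : T^[4 * (e + 1) - j] (rho^[i] (a, b)) = rho^[i + 2 * j] (a + j, b + j) := by
      rw [← key, ← Function.iterate_add_apply, Nat.sub_add_cancel (by omega), per]
    rw [← back, ← Function.iterate_add_apply, Nat.add_comm, Function.iterate_add_apply, h]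

lemma region_cell {T : ℝ × ℝ → ℝ × ℝ}
    (hT : ∀ x p : ℝ × ℝ, IsVertexTangency x p → T x = (2 : ℝ) • p - x)
    (i : ℕ) (m k : ℤ) (hm : 1 ≤ m) (hk : k ≤ 0) {a b : ℝ} (ha : (m : ℝ) < a)
    (ha' : a < m + 1) (hb : (k : ℝ) < b) (hb' : b < k + 1) :
    T^[4 * (m.natAbs + k.natAbs)] (rho^[i] (a, b)) = rho^[i] (a, b) ∧
      ∀ s : ℕ, 0 < s → s < 4 * (m.natAbs + k.natAbs) →
        T^[s] (rho^[i] (a, b)) ≠ rho^[i] (a, b) := by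
  obtain ⟨f, rfl⟩ : ∃ f : ℕ, m = f + 1 := ⟨(m - 1).toNat, by omega⟩
  obtain ⟨j, rfl⟩ : ∃ j : ℕ, k = -(j : ℤ) := ⟨(-k).toNat, by omega⟩
  have := region_main hT i (f + j) j (by omega) (a := a) (b := b)
  push_cast at this ha ha' hb hb'
  have := this (by linarith) (by linarith) (by linarith) (by linarith)
  rwa [show ((f : ℤ) + 1).natAbs + (-(j : ℤ)).natAbs = f + j + 1 by omega]

lemma undef_a {T : ℝ × ℝ → ℝ × ℝ}
    (hT : ∀ x p : ℝ × ℝ, IsVertexTangency x p → T x = (2 : ℝ) • p - x)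
    (n : ℕ) : ∀ (i : ℕ) (b : ℝ), b < 1 →
    (∀ j : ℕ, ∃ p, IsVertexTangency (T^[j] (rho^[i] ((n : ℝ) + 2, b))) p) → False := by
  induction n with
  | zero =>
    intro i b hb h
    obtain ⟨p, hp⟩ := h 1
    rw [Function.iterate_one, step0 hT _ (by norm_num) hb] at hp
    obtain ⟨i', c, d, hc, hd, h⟩ := tangency_region hp
    refine boundary_not (i := i) (j := i') (t := 2 - b) (by linarith) hc hd ?_
    rw [← h]
    norm_num
  | succ n ih =>
    intro i b hb h
    apply ih (i + 2) (b - 1) (by linarith)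
    intro j
    have := h (j + 1)
    rw [Function.iterate_succ_apply, step2 hT _ (by push_cast; linarith [(Nat.cast_nonneg n : (0 : ℝ) ≤ n)]) hb] at this
    convert this using 5
    push_cast
    ring_nf

lemma undef_b {T : ℝ × ℝ → ℝ × ℝ}
    (hT : ∀ x p : ℝ × ℝ, IsVertexTangency x p → T x = (2 : ℝ) • p - x)
    (n : ℕ) : ∀ (i : ℕ) (a : ℝ) (l : ℕ), 1 < a → a < n + 1 →
    (∀ j : ℕ, ∃ p, IsVertexTangency (T^[j] (rho^[i] (a, -(l : ℝ)))) p) → False := by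
  induction n with
  | zero => intro i a l h1 h2; norm_num at h2; linarith
  | succ n ih =>
    intro i a l h1 h2 h
    have hl : (0 : ℝ) ≤ l := Nat.cast_nonneg l
    push_cast at h2
    rcases lt_trichotomy a 2 with h3 | h3 | h3
    · apply undef_a hT l (i + 1) (a - 1) (by linarith)
      intro j
      have := h (j + 1)
      rw [Function.iterate_succ_apply, step1 hT _ h1 (by linarith)] at this
      convert this using 5
      ring
    · subst h3
      apply undef_a hT 0 i (-(l : ℝ)) (by linarith)
      simpa using h
    · apply ih (i + 2) (a - 1) (l + 1) (by linarith) (by linarith)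
      intro j
      have := h (j + 1)
      rw [Function.iterate_succ_apply, step2 hT _ h1 (by linarith)] at this
      convert this using 5
      push_cast
      ring

end dynamics

/-- For the outer billiard map about the unit square: every periodic point has period
divisible by 4; and every point of a unit lattice cell `(m, m+1) × (k, k+1)` with
`(m, k) ≠ (0, 0)`, i.e. at Manhattan distance `d = |m| + |k| ≥ 1` from the square, is
periodic with minimal period exactly `4 d`. -/
theorem square_outerBilliard_periods
    (T : ℝ × ℝ → ℝ × ℝ)
    (hT : ∀ x p : ℝ × ℝ, IsVertexTangency x p → T x = (2 : ℝ) • p - x) :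
    (∀ x : ℝ × ℝ, x ∉ unitSquare → (∀ j : ℕ, ∃ p, IsVertexTangency (T^[j] x) p) →
      ∀ n : ℕ, 0 < n → T^[n] x = x →
        (∀ m : ℕ, 0 < m → T^[m] x = x → n ≤ m) → 4 ∣ n) ∧
    (∀ m k : ℤ, (m, k) ≠ (0, 0) → ∀ x ∈ cell m k,
      T^[4 * (m.natAbs + k.natAbs)] x = x ∧
        ∀ j : ℕ, 0 < j → j < 4 * (m.natAbs + k.natAbs) → T^[j] x ≠ x) := by
  refine ⟨?_, ?_⟩
  · intro x _ hdef n hn hper hmin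
    obtain ⟨p, hp⟩ := hdef 0
    obtain ⟨i, a, b, ha, hb, hx⟩ := tangency_region hp
    rw [Function.iterate_zero, id] at hx
    subst hx
    have hm : 1 ≤ ⌊a⌋ := Int.le_floor.2 (by push_cast; exact ha.le)
    have hk : ⌊b⌋ ≤ 0 := Int.lt_add_one_iff.1 (Int.floor_lt.2 (by push_cast; linarith))
    have ha1 : (⌊a⌋ : ℝ) < a := by
      refine lt_of_le_of_ne (Int.floor_le a) fun h => ?_
      have h2 : 2 ≤ ⌊a⌋ := by
        have : (1 : ℝ) < ⌊a⌋ := by rw [h]; exact ha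
        exact_mod_cast this
      obtain ⟨f, hf⟩ : ∃ f : ℕ, ⌊a⌋ = f + 2 := ⟨(⌊a⌋ - 2).toNat, by omega⟩
      rw [hf] at h
      push_cast at h
      subst h
      exact undef_a hT f i b hb hdef
    have hb1 : (⌊b⌋ : ℝ) < b := by
      refine lt_of_le_of_ne (Int.floor_le b) fun h => ?_
      obtain ⟨l, hl⟩ : ∃ l : ℕ, ⌊b⌋ = -(l : ℤ) := ⟨(-⌊b⌋).toNat, by omega⟩
      rw [hl] at h
      push_cast at h
      subst h
      obtain ⟨N, hN⟩ := exists_nat_gt a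
      exact undef_b hT N i a l ha (by linarith) hdef
    obtain ⟨h1, h2⟩ := region_cell hT i ⌊a⌋ ⌊b⌋ hm hk ha1 (Int.lt_floor_add_one a) hb1
      (Int.lt_floor_add_one b)
    have hle := hmin _ (by omega) h1
    rcases lt_or_eq_of_le hle with h | h
    · exact absurd hper (h2 n hn h)
    · exact ⟨_, h⟩
  · rintro m k hmk ⟨a, b⟩ hx
    simp only [cell, Set.mem_prod, Set.mem_Ioo] at hx
    obtain ⟨⟨h1, h2⟩, h3, h4⟩ := hx
    have hmk' : ¬ (m = 0 ∧ k = 0) := by simpa using hmk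
    have hc : (1 ≤ m ∧ k ≤ 0) ∨ (1 ≤ k ∧ 0 ≤ m) ∨ (m ≤ -1 ∧ 0 ≤ k) ∨ (k ≤ -1 ∧ m ≤ 0) := by
      omega
    rcases hc with ⟨hm, hk⟩ | ⟨hk, hm⟩ | ⟨hm, hk⟩ | ⟨hk, hm⟩
    · exact region_cell hT 0 m k hm hk h1 h2 h3 h4
    · have := region_cell hT 1 k (-m) (by omega) (by omega) (a := b) (b := 1 - a) h3 h4
        (by push_cast; linarith) (by push_cast; linarith)
      rw [show rho^[1] (b, 1 - a) = (a, b) by ext <;> simp [rho]] at this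
      rwa [show m.natAbs + k.natAbs = k.natAbs + (-m).natAbs by omega]
    · have := region_cell hT 2 (-m) (-k) (by omega) (by omega) (a := 1 - a) (b := 1 - b)
        (by push_cast; linarith) (by push_cast; linarith)
        (by push_cast; linarith) (by push_cast; linarith)
      rw [show rho^[2] (1 - a, 1 - b) = (a, b) by ext <;> simp [rho]] at this
      rwa [show m.natAbs + k.natAbs = (-m).natAbs + (-k).natAbs by omega]
    · have := region_cell hT 3 (-k) m (by omega) (by omega) (a := 1 - b) (b := a)
        (by push_cast; linarith) (by push_cast; linarith) h1 h2
      rw [show rho^[3] (1 - b, a) = (a, b) by ext <;> simp [rho]] at this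
      rwa [show m.natAbs + k.natAbs = (-k).natAbs + m.natAbs by omega]
end

section
/- For the outer billiard map T about a convex polygon, each connected component of the complement of the closure of the set of points with finite orbit is an open bounded convex set, and T maps each such component isometrically onto another such component (when T is defined on it). -/
/-- The polygonal table: the convex hull of the finite vertex set `V`. -/
def table (V : Finset (ℝ × ℝ)) : Set (ℝ × ℝ) := convexHull ℝ (V : Set (ℝ × ℝ))

/-- `p` is the vertex of the polygon with vertex set `V` at which the right tangent line
from `x` touches the polygon (strict tangency; this fails exactly on the rays extending
the sides, where the outer billiard map is undefined). -/
def tangVert (V : Finset (ℝ × ℝ)) (x p : ℝ × ℝ) : Prop :=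
  p ∈ V ∧ ∀ q ∈ table V, q ≠ p → 0 < cross (p - x) (q - x)

/-- The domain of definition of the outer billiard map about the polygon with vertices
`V`. -/
def dom (V : Finset (ℝ × ℝ)) : Set (ℝ × ℝ) :=
  {x | x ∉ table V ∧ ∃ p, tangVert V x p}

/-- The set `A₀` of points (outside the table) with finite orbit: some iterate leaves the
domain of definition. -/
def finiteOrbitSet (V : Finset (ℝ × ℝ)) (T : ℝ × ℝ → ℝ × ℝ) : Set (ℝ × ℝ) :=
  {x | x ∉ table V ∧ ∃ n : ℕ, T^[n] x ∉ dom V}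

/-- The complement, outside the table, of the closure of the set of finite-orbit points. -/
def goodRegion (V : Finset (ℝ × ℝ)) (T : ℝ × ℝ → ℝ × ℝ) : Set (ℝ × ℝ) :=
  (table V)ᶜ \ closure (finiteOrbitSet V T)

namespace OB

def toC (w : ℝ × ℝ) : ℂ := ⟨w.1, w.2⟩

noncomputable def ang (w w' : ℝ × ℝ) : ℝ := Complex.arg (toC w' / toC w)

noncomputable def lft (d w : ℝ × ℝ) : ℝ := Complex.arg (toC w * ⟨-d.2, -d.1⟩)

lemma arg_div_of_re_pos {z w : ℂ} (hz : 0 < z.re) (hw : 0 < w.re) :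
    Complex.arg (z / w) = Complex.arg z - Complex.arg w := by
  have h1 := abs_lt.1 (Complex.abs_arg_lt_pi_div_two_iff.2 (Or.inl hz))
  have h2 := abs_lt.1 (Complex.abs_arg_lt_pi_div_two_iff.2 (Or.inl hw))
  have hw0 : w ≠ 0 := by rintro rfl; simp at hw
  have hz0 : z ≠ 0 := by rintro rfl; simp at hz
  have hpi := Real.pi_pos
  have hinv : Complex.arg w⁻¹ = - Complex.arg w := by
    rw [Complex.arg_inv, if_neg]
    intro h; linarith [h2.1, h2.2]
  rw [div_eq_mul_inv, Complex.arg_mul hz0 (inv_ne_zero hw0), hinv]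
  · ring
  · rw [hinv]; constructor <;> linarith [h1.1, h1.2, h2.1, h2.2]

lemma toC_lft_re (d w : ℝ × ℝ) : (toC w * (⟨-d.2, -d.1⟩ : ℂ)).re = cross d w := by
  simp [toC, cross]; ring

lemma ang_eq_lft {d w w' : ℝ × ℝ} (h : 0 < cross d w) (h' : 0 < cross d w') :
    ang w w' = lft d w' - lft d w := by
  rw [← toC_lft_re] at h h'
  have hne : (⟨-d.2, -d.1⟩ : ℂ) ≠ 0 := by
    intro h0; rw [h0] at h; simp at h
  unfold ang lft
  rw [← arg_div_of_re_pos h' h, mul_div_mul_right _ _ hne]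

lemma ang_neg (w w' : ℝ × ℝ) : ang (-w) (-w') = ang w w' := by
  have : ∀ w : ℝ × ℝ, toC (-w) = - toC w := by
    intro w; apply Complex.ext <;> simp [toC]
  simp [ang, this]

lemma ang_neg_of_cross {w w' : ℝ × ℝ} (h : cross w w' < 0) : ang w w' < 0 := by
  unfold ang
  rw [Complex.arg_neg_iff]
  have hw : toC w ≠ 0 := by
    intro h0
    have h1 := congrArg Complex.re h0
    have h2 := congrArg Complex.im h0
    simp [toC] at h1 h2
    simp [cross, h1, h2] at h
  have hn : 0 < Complex.normSq (toC w) := Complex.normSq_pos.2 hw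
  rw [Complex.div_im]
  have : (toC w').im * (toC w).re / Complex.normSq (toC w) -
    (toC w').re * (toC w).im / Complex.normSq (toC w) = cross w w' / Complex.normSq (toC w) := by
    simp only [toC, cross]; ring
  rw [this]
  exact div_neg_of_neg_of_pos h hn

/-- total angle of the chain with contact points `k0`, `k1` seen from `x` -/
noncomputable def tot (n : ℕ) (k0 k1 : ℕ → ℝ × ℝ) (x : ℝ × ℝ) : ℝ :=
  ∑ m ∈ Finset.range n, (ang (k0 m - x) (k1 m - x) + ang (k1 m - x) (k0 (m+1) - x))

lemma sum_shift (n : ℕ) (f : ℕ → ℝ) (hf : ∀ m, f (m + n) = f m) (s : ℕ) :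
    ∑ m ∈ Finset.range n, f (m + s) = ∑ m ∈ Finset.range n, f m := by
  induction s with
  | zero => simp
  | succ s ih =>
    rw [← ih]
    have h1 := Finset.sum_range_succ (fun m => f (m + s)) n
    have h2 := Finset.sum_range_succ' (fun m => f (m + s)) n
    have h3 : f (n + s) = f (0 + s) := by rw [add_comm n s, hf]; simp
    have h4 : ∀ m, f (m + 1 + s) = f (m + (s + 1)) := fun m => by congr 1; ring
    simp only [h4] at h2
    linarith

lemma tot_step (l : ℕ) (k0 k1 : ℕ → ℝ × ℝ) (h0 : ∀ m, k0 (m + 2*l) = k0 m)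
    (h1 : ∀ m, k1 (m + 2*l) = k1 m) (x x' : ℝ × ℝ)
    (hA : ∀ m, ∃ d, 0 < cross d (k0 m - x) ∧ 0 < cross d (k1 m - x) ∧
      0 < cross d (x' - k1 (m + l)) ∧ 0 < cross d (x' - k0 (m + l + 1)))
    (hB : ∀ m, ∃ d, 0 < cross d (k1 m - x) ∧ 0 < cross d (k0 (m+1) - x) ∧
      0 < cross d (x' - k0 (m + l + 1)) ∧ 0 < cross d (x' - k1 (m + l + 1))) :
    tot (2*l) k0 k1 x' = tot (2*l) k0 k1 x := by
  have e1 : tot (2*l) k0 k1 x' = ∑ m ∈ Finset.range (2*l),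
      (ang (k0 (m+l+1) - x') (k1 (m+l+1) - x') + ang (k1 (m+l) - x') (k0 (m+l+1) - x')) := by
    unfold tot
    rw [Finset.sum_add_distrib, Finset.sum_add_distrib]
    congr 1
    · have := sum_shift (2*l) (fun m => ang (k0 m - x') (k1 m - x')) (by
        intro m; simp only [h0, h1]) (l+1)
      rw [← this]; rfl
    · have := sum_shift (2*l) (fun m => ang (k1 m - x') (k0 (m+1) - x')) (by
        intro m
        have : m + 2*l + 1 = m + 1 + 2*l := by ring
        simp only [this, h0, h1]) l
      rw [← this]
  set g0 : ℕ → ℝ := fun m => ang (k0 m - x) (x' - k1 (m+l)) with hg0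
  set g1 : ℕ → ℝ := fun m => ang (k1 m - x) (x' - k0 (m+l+1)) with hg1
  have e2 : ∀ m, ang (k1 (m+l) - x') (k0 (m+l+1) - x') =
      ang (k0 m - x) (k1 m - x) + g1 m - g0 m := by
    intro m
    obtain ⟨d, a1, a2, a3, a4⟩ := hA m
    rw [← ang_neg, neg_sub, neg_sub, hg0, hg1]
    simp only
    rw [ang_eq_lft a3 a4, ang_eq_lft a1 a2, ang_eq_lft a2 a4, ang_eq_lft a1 a3]; ring
  have e3 : ∀ m, ang (k0 (m+l+1) - x') (k1 (m+l+1) - x') =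
      ang (k1 m - x) (k0 (m+1) - x) + g0 (m+1) - g1 m := by
    intro m
    obtain ⟨d, a1, a2, a3, a4⟩ := hB m
    have e : m + 1 + l = m + l + 1 := by ring
    rw [← ang_neg, neg_sub, neg_sub, hg0, hg1]
    simp only [e]
    rw [ang_eq_lft a3 a4, ang_eq_lft a1 a2, ang_eq_lft a2 a4, ang_eq_lft a1 a3]; ring
  have e4 : ∑ m ∈ Finset.range (2*l), g0 (m+1) = ∑ m ∈ Finset.range (2*l), g0 m :=
    sum_shift (2*l) g0 (by
      intro m
      have : m + 2*l + l = m + l + 2*l := by ring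
      simp only [hg0, this, h0, h1]) 1
  rw [e1]
  have : tot (2*l) k0 k1 x = tot (2*l) k0 k1 x + (∑ m ∈ Finset.range (2*l), g0 (m+1) -
    ∑ m ∈ Finset.range (2*l), g0 m) := by rw [e4]; ring
  rw [this, tot, ← Finset.sum_sub_distrib, ← Finset.sum_add_distrib]
  apply Finset.sum_congr rfl
  intro m _
  rw [e2, e3]; ring

lemma tot_far (n : ℕ) (k0 k1 : ℕ → ℝ × ℝ) (h0 : k0 n = k0 0) (x d : ℝ × ℝ)
    (hd0 : ∀ m, 0 < cross d (k0 m - x)) (hd1 : ∀ m, 0 < cross d (k1 m - x)) :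
    tot n k0 k1 x = 0 := by
  have : ∀ m, ang (k0 m - x) (k1 m - x) + ang (k1 m - x) (k0 (m+1) - x) =
      lft d (k0 (m+1) - x) - lft d (k0 m - x) := by
    intro m
    rw [ang_eq_lft (hd0 m) (hd1 m), ang_eq_lft (hd1 m) (hd0 (m+1))]; ring
  unfold tot
  rw [Finset.sum_congr rfl (fun m _ => this m), Finset.sum_range_sub (fun m => lft d (k0 m - x)), h0]
  ring

lemma tot_near (n : ℕ) (hn : 0 < n) (k0 k1 : ℕ → ℝ × ℝ) (x : ℝ × ℝ)
    (hd0 : ∀ m, cross (k0 m - x) (k1 m - x) < 0)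
    (hd1 : ∀ m, cross (k1 m - x) (k0 (m+1) - x) < 0) :
    tot n k0 k1 x < 0 := by
  unfold tot
  apply Finset.sum_neg
  · intro m _
    have := ang_neg_of_cross (hd0 m)
    have := ang_neg_of_cross (hd1 m)
    linarith
  · exact ⟨0, by simpa using hn⟩

end OB

namespace OB

lemma cross_def (u v : ℝ × ℝ) : cross u v = u.1 * v.2 - u.2 * v.1 := rfl

lemma table_ind (V : Finset (ℝ × ℝ)) (c d : ℝ × ℝ) (e : ℝ) (h : ∀ v ∈ V, e ≤ cross (c + v) d) :
    ∀ y ∈ table V, e ≤ cross (c + y) d := by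
  intro y hy
  have hc : Convex ℝ {y : ℝ × ℝ | e ≤ cross (c + y) d} := by
    intro y1 h1 y2 h2 a b ha hb hab
    simp only [Set.mem_ofPred_eq, cross, Prod.fst_add, Prod.snd_add, Prod.smul_fst, Prod.smul_snd,
      smul_eq_mul] at h1 h2 ⊢
    obtain rfl : b = 1 - a := by linarith
    nlinarith [mul_le_mul_of_nonneg_left h1 ha, mul_le_mul_of_nonneg_left h2 hb]
  exact convexHull_min (fun v hv => h v hv) hc hy

lemma table_ind' (V : Finset (ℝ × ℝ)) (c d : ℝ × ℝ) (e : ℝ) (h : ∀ v ∈ V, e ≤ cross (c - v) d) :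
    ∀ y ∈ table V, e ≤ cross (c - y) d := by
  intro y hy
  have key : ∀ w, cross (-c + w) (-d) = cross (c - w) d := by
    intro w; simp [cross]; ring
  rw [← key]
  exact table_ind V (-c) (-d) e (fun v hv => by rw [key]; exact h v hv) y hy

lemma table_closed (V : Finset (ℝ × ℝ)) : IsClosed (table V) :=
  (V.finite_toSet.isCompact_convexHull (𝕜 := ℝ)).isClosed

lemma mem_table {V : Finset (ℝ × ℝ)} {v : ℝ × ℝ} (h : v ∈ V) : v ∈ table V :=
  subset_convexHull ℝ _ h

lemma sep_bead (B : Set (ℝ × ℝ)) (hBc : IsClosed B) (hBv : Convex ℝ B) (x a q : ℝ × ℝ) (ε : ℝ)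
    (hxB : x ∉ B) (hB : ∀ y ∈ B, -ε ≤ cross (q - y) (a - q))
    (hm : q ≠ a → ε < cross (a - x) (q - a)) :
    ∃ d, ∀ y ∈ B, 0 < cross d (y - x) ∧ 0 < cross d ((2:ℝ) • a - x - ((2:ℝ) • q - y)) := by
  by_cases h : q = a
  · subst h
    obtain ⟨f, u, h1, h2⟩ := geometric_hahn_banach_point_closed hBv hBc hxB
    refine ⟨(f (0,1), - f (1,0)), fun y hy => ?_⟩
    have key : ∀ w : ℝ × ℝ, cross (f (0,1), - f (1,0)) w = f w := by
      intro w
      have : w = w.1 • ((1:ℝ),(0:ℝ)) + w.2 • ((0:ℝ),(1:ℝ)) := by ext <;> simp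
      conv_rhs => rw [this, map_add, map_smul, map_smul]
      simp [cross]; ring
    have e : (2:ℝ) • q - x - ((2:ℝ) • q - y) = y - x := by abel
    rw [e, key, map_sub]
    have := h2 y hy
    constructor <;> linarith
  · refine ⟨a - q, fun y hy => ?_⟩
    have h1 := hB y hy
    have h2 := hm h
    simp only [cross, Prod.fst_sub, Prod.snd_sub, Prod.smul_fst, Prod.smul_snd, smul_eq_mul] at *
    constructor <;> linarith

lemma barrier (V : Finset (ℝ × ℝ)) (l : ℕ) (hl : 1 ≤ l) (A Z : ℕ → ℝ × ℝ)
    (hAV : ∀ m, A m ∈ V) (hper : ∀ m, A (m + 2*l) = A m)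
    (hZ1 : ∀ m, Z (m+1) = Z m + (2:ℝ) • (A (m+l) - A m)) (hZl : ∀ m, Z (m+l) = - Z m)
    (ε : ℝ)
    (hi : ∀ m, ∀ v ∈ V, ∀ y ∈ V, -ε ≤ cross (A m - Z m - y) (v - A m))
    (hii : ∀ m, ∀ v ∈ V, ∀ y ∈ V, -ε ≤ cross (A m - Z m - (2:ℝ) • A (m+l) + y) (v - A m))
    (x a : ℕ → ℝ × ℝ) (ha : ∀ n, a n ∈ V) (hx : ∀ n, x (n+1) = (2:ℝ) • a n - x n)
    (hm : ∀ n, ∀ q ∈ V, q ≠ a n → ε < cross (a n - x n) (q - a n))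
    (h1 : ∀ m, cross (Z m + A (m+l) - x 0) (Z m + (2:ℝ) • A (m+l) - A m - x 0) < 0)
    (h2 : ∀ m, cross (Z m + (2:ℝ) • A (m+l) - A m - x 0) (Z (m+1) + A (m+1+l) - x 0) < 0)
    (h3 : ∀ m, x 0 - Z m ∉ table V) (h4 : ∀ m, Z m + (2:ℝ) • A (m+l) - x 0 ∉ table V) :
    ∃ R : ℝ, ∀ n, ‖x n‖ ≤ R := by
  set k0 : ℕ → ℝ × ℝ := fun m => Z m + A (m+l) with hk0
  set k1 : ℕ → ℝ × ℝ := fun m => Z m + (2:ℝ) • A (m+l) - A m with hk1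
  have hZ2 : ∀ m, Z (m + 2*l) = Z m := by
    intro m
    have : m + 2*l = m + l + l := by ring
    rw [this, hZl, hZl, neg_neg]
  have hA2 : ∀ m, A (m + l + l) = A m := by
    intro m
    have : m + l + l = m + 2*l := by ring
    rw [this, hper]
  have p0 : ∀ m, k0 (m + 2*l) = k0 m := by
    intro m
    have : m + 2*l + l = m + l + 2*l := by ring
    simp only [hk0, hZ2, this, hper]
  have p1 : ∀ m, k1 (m + 2*l) = k1 m := by
    intro m
    have : m + 2*l + l = m + l + 2*l := by ring
    simp only [hk1, hZ2, this, hper]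
  -- separation
  have sP : ∀ n m, x n - Z m ∉ table V → ∃ d, ∀ y, y - Z m ∈ table V →
      0 < cross d (y - x n) ∧ 0 < cross d (x (n+1) - ((2:ℝ) • A m - y)) := by
    intro n m hn
    rw [hx]
    have := sep_bead {y | y - Z m ∈ table V} ((table_closed V).preimage (by fun_prop))
      (by
        have := (convex_convexHull ℝ (V : Set (ℝ × ℝ))).translate_preimage_right (-Z m)
        have e : {y | y - Z m ∈ table V} = (fun z => -Z m + z) ⁻¹' (convexHull ℝ (V : Set (ℝ × ℝ))) := by
          ext y; simp only [Set.mem_ofPred_eq, Set.mem_preimage, table]; rw [neg_add_eq_sub]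
        rw [e]; exact this) (x n) (a n) (A m) ε hn
      (by
        intro y hy
        have := table_ind' V (A m - Z m) (a n - A m) (-ε) (fun v hv => hi m _ (ha n) v hv) _ hy
        have e : A m - Z m - (y - Z m) = A m - y := by abel
        rwa [e] at this)
      (fun h => hm n _ (hAV m) h)
    exact this
  have sM : ∀ n m, Z m + (2:ℝ) • A (m+l) - x n ∉ table V → ∃ d, ∀ y, Z m + (2:ℝ) • A (m+l) - y ∈ table V →
      0 < cross d (y - x n) ∧ 0 < cross d (x (n+1) - ((2:ℝ) • A m - y)) := by
    intro n m hn
    rw [hx]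
    have := sep_bead {y | Z m + (2:ℝ) • A (m+l) - y ∈ table V} ((table_closed V).preimage (by fun_prop))
      (by
        intro y1 h1 y2 h2 s t hs ht hst
        have := (convex_convexHull ℝ (V : Set (ℝ × ℝ))) h1 h2 hs ht hst
        simp only [Set.mem_ofPred_eq, table]
        convert this using 1
        rw [smul_sub, smul_sub]
        obtain rfl : t = 1 - s := by linarith
        module) (x n) (a n) (A m) ε hn
      (by
        intro y hy
        have := table_ind V (A m - Z m - (2:ℝ) • A (m+l)) (a n - A m) (-ε) (fun v hv => hii m _ (ha n) v hv) _ hy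
        have e : A m - Z m - (2:ℝ) • A (m+l) + (Z m + (2:ℝ) • A (m+l) - y) = A m - y := by abel
        rwa [e] at this)
      (fun h => hm n _ (hAV m) h)
    exact this
  have cross0 : ∀ d, cross d 0 = 0 := by intro d; simp [cross]
  -- invariant
  have inv : ∀ n, (∀ m, x n - Z m ∉ table V) ∧ (∀ m, Z m + (2:ℝ) • A (m+l) - x n ∉ table V) := by
    intro n
    induction n with
    | zero => exact ⟨h3, h4⟩
    | succ n ih =>
      constructor
      · intro m' hmem
        obtain ⟨l', rfl⟩ : ∃ l', l = l' + 1 := ⟨l - 1, by omega⟩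
        obtain ⟨d, hd⟩ := sM n (m' + l') (ih.2 _)
        have e : m' + 2*(l'+1) = (m' + l') + 1 + (l' + 1) := by ring
        have hz := hZ2 m'
        rw [e, hZl, hZ1] at hz
        have := (hd ((2:ℝ) • A (m' + l') - x (n+1)) (by
          convert hmem using 1
          rw [← hz]
          module)).2
        have e2 : x (n+1) - ((2:ℝ) • A (m'+l') - ((2:ℝ) • A (m' + l') - x (n+1))) = 0 := by abel
        rw [e2, cross0] at this
        exact lt_irrefl _ this
      · intro m' hmem
        obtain ⟨d, hd⟩ := sP n (m' + l) (ih.1 _)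
        have := (hd ((2:ℝ) • A (m' + l) - x (n+1)) (by
          convert hmem using 1
          rw [hZl]
          module)).2
        have e2 : x (n+1) - ((2:ℝ) • A (m'+l) - ((2:ℝ) • A (m' + l) - x (n+1))) = 0 := by abel
        rw [e2, cross0] at this
        exact lt_irrefl _ this
  have cons : ∀ n, tot (2*l) k0 k1 (x n) = tot (2*l) k0 k1 (x 0) := by
    intro n
    induction n with
    | zero => rfl
    | succ n ih =>
      rw [← ih]
      apply tot_step l k0 k1 p0 p1
      · intro m
        obtain ⟨d, hd⟩ := sM n m ((inv n).2 m)
        refine ⟨d, (hd (k0 m) ?_).1, (hd (k1 m) ?_).1, ?_, ?_⟩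
        · have : Z m + (2:ℝ) • A (m+l) - k0 m = A (m+l) := by simp only [hk0]; module
          rw [this]; exact mem_table (hAV _)
        · have : Z m + (2:ℝ) • A (m+l) - k1 m = A m := by simp only [hk1]; module
          rw [this]; exact mem_table (hAV _)
        · have := (hd ((2:ℝ) • A m - k1 (m+l)) (by
            have : Z m + (2:ℝ) • A (m+l) - ((2:ℝ) • A m - k1 (m+l)) = A (m+l) := by
              simp only [hk1, hA2, hZl]; module
            rw [this]; exact mem_table (hAV _))).2
          convert this using 2; abel
        · have := (hd ((2:ℝ) • A m - k0 (m+l+1)) (by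
            have : Z m + (2:ℝ) • A (m+l) - ((2:ℝ) • A m - k0 (m+l+1)) = A (m+1) := by
              have e : m + l + 1 + l = m + 1 + l + l := by ring
              simp only [hk0, hZ1, hZl, e, hA2]; module
            rw [this]; exact mem_table (hAV _))).2
          convert this using 2; abel
      · intro m
        obtain ⟨d, hd⟩ := sP n (m+1) ((inv n).1 (m+1))
        refine ⟨d, (hd (k1 m) ?_).1, (hd (k0 (m+1)) ?_).1, ?_, ?_⟩
        · have : k1 m - Z (m+1) = A m := by simp only [hk1, hZ1]; module
          rw [this]; exact mem_table (hAV _)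
        · have : k0 (m+1) - Z (m+1) = A (m+1+l) := by simp only [hk0]; module
          rw [this]; exact mem_table (hAV _)
        · have := (hd ((2:ℝ) • A (m+1) - k0 (m+l+1)) (by
            have : (2:ℝ) • A (m+1) - k0 (m+l+1) - Z (m+1) = A (m+1) := by
              have e : m + l + 1 + l = m + 1 + l + l := by ring
              simp only [hk0, hZ1, hZl, e, hA2]; module
            rw [this]; exact mem_table (hAV _))).2
          convert this using 2; abel
        · have := (hd ((2:ℝ) • A (m+1) - k1 (m+l+1)) (by
            have : (2:ℝ) • A (m+1) - k1 (m+l+1) - Z (m+1) = A (m+1+l) := by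
              have e : m + l + 1 + l = m + 1 + l + l := by ring
              have e' : m + l + 1 = m + 1 + l := by ring
              simp only [hk1, e, hA2]
              rw [e', hZl]; module
            rw [this]; exact mem_table (hAV _))).2
          convert this using 2; abel
  have near : tot (2*l) k0 k1 (x 0) < 0 := tot_near (2*l) (by omega) k0 k1 (x 0) h1 h2
  -- bound of contacts
  have bd : ∀ k : ℕ → ℝ × ℝ, (∀ m, k (m + 2*l) = k m) → ∃ R, ∀ m, ‖k m‖ ≤ R := by
    intro k hk
    refine ⟨∑ m ∈ Finset.range (2*l), ‖k m‖, fun m => ?_⟩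
    have : k m = k (m % (2*l)) := (Function.Periodic.map_mod_nat hk m).symm
    rw [this]
    exact Finset.single_le_sum (f := fun m => ‖k m‖) (fun _ _ => norm_nonneg _)
      (Finset.mem_range.2 (Nat.mod_lt _ (by omega)))
  obtain ⟨R0, hR0⟩ := bd k0 p0
  obtain ⟨R1, hR1⟩ := bd k1 p1
  refine ⟨2 * max R0 R1, fun n => ?_⟩
  by_contra hcon
  push Not at hcon
  have far : ∀ k : ℝ × ℝ, ‖k‖ ≤ max R0 R1 → 0 < cross (-(x n).2, (x n).1) (k - x n) := by
    intro k hk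
    have hpos : 0 < ‖x n‖ := by
      have := norm_nonneg k
      linarith
    have e : cross (-(x n).2, (x n).1) (k - x n) =
      (x n).1^2 + (x n).2^2 - (x n).1 * k.1 - (x n).2 * k.2 := by
      simp [cross]; ring
    have b1 : |(x n).1| ≤ ‖x n‖ := norm_fst_le (x n)
    have b2 : |(x n).2| ≤ ‖x n‖ := norm_snd_le (x n)
    have c1 : |k.1| ≤ max R0 R1 := (norm_fst_le k).trans hk
    have c2 : |k.2| ≤ max R0 R1 := (norm_snd_le k).trans hk
    have d1 : (x n).1 * k.1 ≤ ‖x n‖ * max R0 R1 := by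
      refine (le_abs_self _).trans ?_
      rw [abs_mul]; exact mul_le_mul b1 c1 (abs_nonneg _) hpos.le
    have d2 : (x n).2 * k.2 ≤ ‖x n‖ * max R0 R1 := by
      refine (le_abs_self _).trans ?_
      rw [abs_mul]; exact mul_le_mul b2 c2 (abs_nonneg _) hpos.le
    have f : ‖x n‖ ^ 2 ≤ (x n).1^2 + (x n).2^2 := by
      rw [Prod.norm_def]
      rcases max_choice ‖(x n).1‖ ‖(x n).2‖ with h | h <;> rw [h, Real.norm_eq_abs, sq_abs]
      · nlinarith [sq_nonneg (x n).2]
      · nlinarith [sq_nonneg (x n).1]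
    rw [e]
    nlinarith
  have := tot_far (2*l) k0 k1 (by simpa using p0 0) (x n) _
    (fun m => far _ ((hR0 m).trans (le_max_left _ _)))
    (fun m => far _ ((hR1 m).trans (le_max_right _ _)))
  rw [cons n] at this
  linarith

end OB

namespace OB

noncomputable def uu (θ : ℝ) : ℝ × ℝ := (Real.cos θ, - Real.sin θ)

lemma cross_uu (θ φ : ℝ) : cross (uu θ) (uu φ) = Real.sin (θ - φ) := by
  simp [cross, uu, Real.sin_sub]; ring

lemma uu_add_pi (θ : ℝ) : uu (θ + Real.pi) = - uu θ := by
  ext <;> simp [uu]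

lemma cross_add_r (a b c : ℝ × ℝ) : cross a (b + c) = cross a b + cross a c := by
  simp [cross]; ring
lemma cross_sub_r (a b c : ℝ × ℝ) : cross a (b - c) = cross a b - cross a c := by
  simp [cross]; ring
lemma cross_smul_r (a b : ℝ × ℝ) (t : ℝ) : cross a (t • b) = t * cross a b := by
  simp [cross]; ring
lemma cross_add_l (a b c : ℝ × ℝ) : cross (a + b) c = cross a c + cross b c := by
  simp [cross]; ring
lemma cross_sub_l (a b c : ℝ × ℝ) : cross (a - b) c = cross a c - cross b c := by
  simp [cross]; ring
lemma cross_smul_l (a b : ℝ × ℝ) (t : ℝ) : cross (t • a) b = t * cross a b := by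
  simp [cross]; ring
lemma cross_neg_l (a b : ℝ × ℝ) : cross (-a) b = - cross a b := by
  simp [cross]; ring
lemma cross_self (a : ℝ × ℝ) : cross a a = 0 := by
  simp [cross]; ring
lemma cross_swap (a b : ℝ × ℝ) : cross a b = - cross b a := by
  simp [cross]; ring

lemma cross_uu_zero {θ : ℝ} {w : ℝ × ℝ} (h : cross (uu θ) w = 0) : ∃ c : ℝ, w = c • uu θ := by
  refine ⟨w.1 * Real.cos θ - w.2 * Real.sin θ, ?_⟩
  simp only [cross, uu] at h
  have hs := Real.sin_sq_add_cos_sq θ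
  ext
  · simp only [uu, Prod.smul_fst, smul_eq_mul]
    linear_combination (-w.1) * hs  + Real.sin θ * h
  · simp only [uu, Prod.smul_snd, smul_eq_mul]
    linear_combination (-w.2) * hs  + Real.cos θ * h

/-- there is no linear functional `cross d` constant on `V` -/
lemma not_collinear (V : Finset (ℝ × ℝ)) (hint : (interior (table V)).Nonempty) (d : ℝ × ℝ)
    (hd : d ≠ 0) (c : ℝ) (h : ∀ v ∈ V, cross d v = c) : False := by
  have h1 : ∀ y ∈ table V, cross d y = c := by
    intro y hy
    have hc : Convex ℝ {y : ℝ × ℝ | cross d y = c} := by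
      intro y1 h1 y2 h2 a b ha hb hab
      simp only [Set.mem_ofPred_eq] at *
      rw [cross_add_r, cross_smul_r, cross_smul_r, h1, h2, ← add_mul, hab, one_mul]
    exact convexHull_min (fun v hv => h v hv) hc hy
  obtain ⟨z, hz⟩ := hint
  have hopen := mem_interior_iff_mem_nhds.1 hz
  have hcont : Filter.Tendsto (fun t : ℝ => z + t • ((-d.2, d.1) : ℝ × ℝ)) (nhds 0) (nhds z) := by
    have : Continuous (fun t : ℝ => z + t • ((-d.2, d.1) : ℝ × ℝ)) := by fun_prop
    simpa using this.tendsto 0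
  have hev := hcont.eventually hopen
  obtain ⟨δ, hδ, hb⟩ := Metric.eventually_nhds_iff.1 hev
  have h2 := h1 _ (hb (y := δ/2) (by simp [abs_of_pos hδ, hδ]))
  have h3 := h1 _ (interior_subset hz)
  rw [cross_add_r, cross_smul_r, h3] at h2
  have h4 : cross d (-d.2, d.1) = 0 := by
    have : δ/2 * cross d (-d.2, d.1) = 0 := by linarith
    rcases mul_eq_zero.1 this with h | h
    · linarith
    · exact h
  simp only [cross] at h4
  apply hd
  have a1 : d.1 = 0 := by nlinarith [sq_nonneg d.1, sq_nonneg d.2]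
  have a2 : d.2 = 0 := by nlinarith [sq_nonneg d.1, sq_nonneg d.2]
  ext <;> simp [a1, a2]

def bad (V : Finset (ℝ × ℝ)) (θ : ℝ) : Prop := ∃ q ∈ V, ∃ q' ∈ V, q ≠ q' ∧ cross (uu θ) (q - q') = 0

lemma bad_add_pi {V : Finset (ℝ × ℝ)} {θ : ℝ} (h : bad V θ) (k : ℤ) : bad V (θ + k * Real.pi) := by
  obtain ⟨q, hq, q', hq', hne, h0⟩ := h
  refine ⟨q, hq, q', hq', hne, ?_⟩
  obtain ⟨c, hc⟩ := cross_uu_zero h0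
  rw [hc, cross_smul_r, cross_uu]
  have : θ + k * Real.pi - θ = k * Real.pi := by ring
  rw [this, Real.sin_int_mul_pi, mul_zero]

lemma bad_finite (V : Finset (ℝ × ℝ)) : {θ | 0 ≤ θ ∧ θ < Real.pi ∧ bad V θ}.Finite := by
  have : {θ | 0 ≤ θ ∧ θ < Real.pi ∧ bad V θ} ⊆ ⋃ p ∈ (V ×ˢ V : Finset _),
      {θ | p.1 ≠ p.2 ∧ 0 ≤ θ ∧ θ < Real.pi ∧ cross (uu θ) (p.1 - p.2) = 0} := by
    rintro θ ⟨h0, h1, q, hq, q', hq', hne, h⟩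
    simp only [Set.mem_iUnion]
    exact ⟨(q, q'), Finset.mem_product.2 ⟨hq, hq'⟩, hne, h0, h1, h⟩
  refine Set.Finite.subset ?_ this
  refine Set.Finite.biUnion (Finset.finite_toSet _) ?_
  rintro ⟨q, q'⟩ _
  apply Set.Subsingleton.finite
  rintro θ ⟨hne, h0, h1, h⟩ φ ⟨_, g0, g1, g⟩
  obtain ⟨c, hc⟩ := cross_uu_zero h
  simp only at hc g hne
  rw [hc, cross_smul_r, cross_uu] at g
  have hc0 : c ≠ 0 := by
    rintro rfl
    rw [zero_smul, sub_eq_zero] at hc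
    exact hne hc
  have hs := (mul_eq_zero.1 g).resolve_left hc0
  have := (Real.sin_eq_zero_iff_of_lt_of_lt (by linarith) (by linarith)).1 hs
  linarith

/-- the sequence of critical angles -/
lemma angles (V : Finset (ℝ × ℝ)) : ∃ M : ℕ, 1 ≤ M ∧ ∃ θ : ℕ → ℝ,
    (∀ r, θ (r + M) = θ r + Real.pi) ∧ (∀ r, θ r < θ (r+1)) ∧ (∀ r, θ (r+1) < θ r + Real.pi) ∧
    (∀ r φ, θ r < φ → φ < θ (r+1) → ¬ bad V φ) := by
  classical
  have hpi := Real.pi_pos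
  set Θ : Finset ℝ := (bad_finite V).toFinset ∪ {0, Real.pi/2} with hΘ
  have hrange : ∀ t ∈ Θ, 0 ≤ t ∧ t < Real.pi := by
    intro t ht
    rw [hΘ] at ht
    simp only [Finset.mem_union, Set.Finite.mem_toFinset, Finset.mem_insert, Finset.mem_singleton] at ht
    rcases ht with ⟨h0, h1, _⟩ | rfl | rfl
    · exact ⟨h0, h1⟩
    · exact ⟨le_rfl, hpi⟩
    · constructor <;> linarith
  have h0Θ : (0:ℝ) ∈ Θ := by simp [hΘ]
  have h2Θ : Real.pi/2 ∈ Θ := by simp [hΘ]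
  have hM : 2 ≤ Θ.card := by
    have : ({0, Real.pi/2} : Finset ℝ).card = 2 := by
      rw [Finset.card_pair]; linarith
    rw [← this]; exact Finset.card_le_card Finset.subset_union_right
  generalize hMM : Θ.card = M at hM
  set e := Θ.orderEmbOfFin hMM with he
  set E : ℕ → ℝ := fun i => if h : i < M then e ⟨i, h⟩ else 0 with hE
  have hEmem : ∀ i, E i ∈ Θ := by
    intro i
    simp only [hE]; split_ifs with h
    · exact Finset.orderEmbOfFin_mem _ _ _
    · exact h0Θ
  have hElt : ∀ i j, i < j → j < M → E i < E j := by
    intro i j hij hj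
    simp only [hE, hj, hij.trans hj, dif_pos]
    exact e.strictMono hij
  have hEsurj : ∀ t ∈ Θ, ∃ i < M, E i = t := by
    intro t ht
    have : t ∈ Set.range e := by rw [he, Finset.range_orderEmbOfFin]; exact ht
    obtain ⟨i, hi⟩ := this
    exact ⟨i, i.2, by simp [hE, hi]⟩
  have hE0 : E 0 = 0 := by
    obtain ⟨i, hi, h⟩ := hEsurj 0 h0Θ
    rcases Nat.eq_zero_or_pos i with rfl | hp
    · exact h
    · have := hElt 0 i hp hi
      have := (hrange _ (hEmem 0)).1
      linarith
  refine ⟨M, by omega, fun r => E (r % M) + ((r / M : ℕ) : ℝ) * Real.pi, ?_, ?_, ?_, ?_⟩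
  · intro r
    simp only [Nat.add_mod_right]
    rw [Nat.add_div_right _ (by omega)]
    push_cast; ring
  all_goals
    intro r
    have hcase : ((r+1) % M = r % M + 1 ∧ (r+1)/M = r/M) ∨
      (r % M = M - 1 ∧ (r+1) % M = 0 ∧ (r+1)/M = r/M + 1) := by
      have hlt := Nat.mod_lt r (show 0 < M by omega)
      have hdm := Nat.div_add_mod r M
      by_cases h : r % M + 1 < M
      · left
        have h1 : r + 1 = (r % M + 1) + M * (r / M) := by omega
        constructor
        · rw [h1, Nat.add_mul_mod_self_left, Nat.mod_eq_of_lt h]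
        · conv_lhs => rw [h1]
          rw [Nat.add_mul_div_left _ _ (by omega), Nat.div_eq_of_lt h, zero_add]
      · right
        have h1 : r + 1 = M * (r / M + 1) := by rw [mul_add]; omega
        refine ⟨by omega, ?_, ?_⟩
        · rw [h1]; simp
        · conv_lhs => rw [h1]
          rw [Nat.mul_div_cancel_left _ (by omega)]
    have hlt := Nat.mod_lt r (show 0 < M by omega)
    have hr1 := hrange _ (hEmem (r % M))
    have hr2 := hrange _ (hEmem (r % M + 1))
  · rcases hcase with ⟨h1, h2⟩ | ⟨h1, h2, h3⟩
    · simp only [h1, h2]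
      have := hElt (r % M) (r % M + 1) (by omega) (by
        have := Nat.mod_lt (r+1) (show 0 < M by omega); omega)
      linarith
    · simp only [h2, h3, hE0]
      push_cast; linarith
  · rcases hcase with ⟨h1, h2⟩ | ⟨h1, h2, h3⟩
    · simp only [h1, h2]
      linarith
    · simp only [h2, h3, hE0]
      have := hElt 0 (M-1) (by omega) (by omega)
      rw [h1, ← hE0] at *
      push_cast; linarith
  · intro φ hφ1 hφ2 hbad
    set k := r / M with hk
    have hb := bad_add_pi hbad (-(k:ℤ))
    have hφlt : φ + ((-(k:ℤ) : ℤ) : ℝ) * Real.pi < Real.pi := by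
      rcases hcase with ⟨h1, h2⟩ | ⟨h1, h2, h3⟩
      · simp only [h1, h2] at hφ2
        push_cast; linarith
      · simp only [h2, h3, hE0] at hφ2
        push_cast at hφ2 ⊢; linarith
    have hmem : φ + ((-(k:ℤ) : ℤ) : ℝ) * Real.pi ∈ Θ := by
      rw [hΘ]
      apply Finset.mem_union_left
      rw [Set.Finite.mem_toFinset]
      refine ⟨?_, hφlt, hb⟩
      push_cast; simp only at hφ1; linarith
    obtain ⟨i, hi, hEi⟩ := hEsurj _ hmem
    have g1 : E (r % M) < E i := by
      rw [hEi]; push_cast; simp only at hφ1; linarith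
    have g2 : r % M < i := by
      by_contra hcon
      push Not at hcon
      rcases hcon.lt_or_eq with h | h
      · have := hElt _ _ h hlt; linarith
      · rw [h] at g1; exact lt_irrefl _ g1
    rcases hcase with ⟨h1, h2⟩ | ⟨h1, h2, h3⟩
    · simp only [h1, h2] at hφ2
      have : E (r % M + 1) ≤ E i := by
        rcases (Nat.succ_le_of_lt g2).lt_or_eq with h | h
        · exact (hElt _ _ h hi).le
        · rw [← h]
      rw [hEi] at this
      push_cast at this; linarith
    · omega

end OB

namespace OB

structure Dat (V : Finset (ℝ × ℝ)) where
  M : ℕ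
  hM : 1 ≤ M
  a : ℕ → ℝ × ℝ
  t : ℕ → ℝ
  Y : ℕ → ℝ × ℝ
  haV : ∀ r, a r ∈ V
  ha : ∀ r, a (r + 2 * M) = a r
  ht : ∀ r, 0 < t r
  htM : ∀ r, t (r + M) = t r
  hYM : ∀ r, Y (r + M) = - Y r
  hY : ∀ r, Y (r+1) - Y r = (2 * t r) • (a (r + M) - a r)
  h1 : ∀ r, cross (Y r) (a (r+M) - a r) = -1
  D2 : ∀ r, ∀ q ∈ V, cross (Y r) (q - a r) < 0 ∨ ∃ c : ℝ, c ≤ 0 ∧ q - a r = c • Y r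
  D3 : ∀ r, ∀ q ∈ V, cross (Y (r+1)) (q - a r) < 0 ∨ ∃ c : ℝ, 0 ≤ c ∧ q - a r = c • Y (r+1)

lemma uu_cont (w : ℝ × ℝ) : Continuous (fun φ => cross (uu φ) w) := by
  unfold cross uu; fun_prop

lemma exists_dat (V : Finset (ℝ × ℝ)) (hV : V.Nonempty) (hint : (interior (table V)).Nonempty) :
    Nonempty (Dat V) := by
  obtain ⟨M, hM, θ, hθM, hlt, hpi, hgood⟩ := angles V
  set mid : ℕ → ℝ := fun r => (θ r + θ (r+1)) / 2 with hmid
  have mid1 : ∀ r, θ r < mid r := fun r => by simp only [hmid]; linarith [hlt r]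
  have mid2 : ∀ r, mid r < θ (r+1) := fun r => by simp only [hmid]; linarith [hlt r]
  have hex : ∀ r, ∃ a ∈ V, ∀ q ∈ V, cross (uu (mid r)) q ≤ cross (uu (mid r)) a := fun r =>
    V.exists_max_image _ hV
  choose a haV hmax using hex
  have hmids : ∀ r, ∀ q ∈ V, q ≠ a r → cross (uu (mid r)) (q - a r) < 0 := by
    intro r q hq hne
    have h := hmax r q hq
    rw [cross_sub_r]
    rcases h.lt_or_eq with h | h
    · linarith
    · exfalso
      exact hgood r (mid r) (mid1 r) (mid2 r) ⟨q, hq, a r, haV r, hne, by rw [cross_sub_r]; linarith⟩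
  have hopen : ∀ r, ∀ q ∈ V, q ≠ a r → ∀ φ ∈ Set.Ioo (θ r) (θ (r+1)), cross (uu φ) (q - a r) < 0 := by
    intro r q hq hne φ hφ
    by_contra hcon
    push Not at hcon
    have hc := (uu_cont (q - a r)).continuousOn (s := Set.Ioo (θ r) (θ (r+1)))
    have := (isPreconnected_Ioo (a := θ r) (b := θ (r+1))).intermediate_value
      (Set.mem_Ioo.2 ⟨mid1 r, mid2 r⟩) hφ hc ⟨(hmids r q hq hne).le, hcon⟩
    obtain ⟨ψ, hψ, h0⟩ := this
    exact hgood r ψ hψ.1 hψ.2 ⟨q, hq, a r, haV r, hne, h0⟩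
  have hclosed : ∀ r, ∀ q ∈ V, ∀ φ ∈ Set.Icc (θ r) (θ (r+1)), cross (uu φ) (q - a r) ≤ 0 := by
    intro r q hq φ hφ
    by_cases hne : q = a r
    · rw [hne]; simp [cross]
    · have hcl : closure (Set.Ioo (θ r) (θ (r+1))) = Set.Icc (θ r) (θ (r+1)) := closure_Ioo (hlt r).ne
      rw [← hcl] at hφ
      exact closure_minimal (fun φ hφ => (hopen r q hq hne φ hφ).le)
        (isClosed_le (uu_cont _) continuous_const) hφ
  have huM : ∀ r, uu (θ (r+M)) = - uu (θ r) := fun r => by rw [hθM, uu_add_pi]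
  have hmidM : ∀ r, uu (mid (r+M)) = - uu (mid r) := by
    intro r
    rw [← uu_add_pi]; congr 1
    simp only [hmid]
    have : r + M + 1 = r + 1 + M := by ring
    rw [this, hθM, hθM]; ring
  have ha2 : ∀ r, a (r + 2*M) = a r := by
    intro r
    by_contra hne
    have h1 := hmids (r + 2*M) (a r) (haV r) (Ne.symm hne)
    have h2 := hmids r _ (haV _) hne
    have : r + 2*M = r + M + M := by ring
    rw [this, hmidM, hmidM, neg_neg, cross_sub_r] at h1
    rw [this, cross_sub_r] at h2
    linarith
  have haMM : ∀ r, a (r + M + M) = a r := fun r => by rw [← ha2 r]; congr 1; ring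
  have hbmin : ∀ r, ∀ q ∈ V, ∀ φ ∈ Set.Icc (θ r) (θ (r+1)), 0 ≤ cross (uu φ) (q - a (r+M)) := by
    intro r q hq φ hφ
    have := hclosed (r+M) q hq (φ + Real.pi) (by
      have : r + M + 1 = r + 1 + M := by ring
      rw [this, hθM, hθM]; exact ⟨by linarith [hφ.1], by linarith [hφ.2]⟩)
    rw [uu_add_pi, cross_neg_l] at this
    linarith
  have hl : ∀ r, θ r ∈ Set.Icc (θ r) (θ (r+1)) := fun r => ⟨le_rfl, (hlt r).le⟩
  have hr : ∀ r, θ (r+1) ∈ Set.Icc (θ r) (θ (r+1)) := fun r => ⟨(hlt r).le, le_rfl⟩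
  have huu0 : ∀ φ, uu φ ≠ 0 := by
    intro φ h
    have h1 := congrArg Prod.fst h
    have h2 := congrArg Prod.snd h
    simp [uu] at h1 h2
    have := Real.sin_sq_add_cos_sq φ
    rw [h1, h2] at this; norm_num at this
  set h : ℕ → ℝ := fun r => cross (uu (θ r)) (a r - a (r+M)) with hh
  have hhpos : ∀ r, 0 < h r := by
    intro r
    have h0 : 0 ≤ h r := hbmin r _ (haV r) _ (hl r)
    rcases h0.lt_or_eq with h0 | h0
    · exact h0
    · exfalso
      refine not_collinear V hint (uu (θ r)) (huu0 _) (cross (uu (θ r)) (a r)) (fun v hv => ?_)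
      have e1 := hclosed r v hv _ (hl r)
      have e2 := hbmin r v hv _ (hl r)
      simp only [hh] at h0
      rw [cross_sub_r] at e1 e2 h0
      linarith
  have hsucc : ∀ r, h (r+1) = cross (uu (θ (r+1))) (a r - a (r+M)) := by
    intro r
    have e1 := hclosed r (a (r+1)) (haV _) _ (hr r)
    have e2 := hclosed (r+1) (a r) (haV _) _ (hl (r+1))
    have e3 := hbmin r (a (r+1+M)) (haV _) _ (hr r)
    have e4 := hbmin (r+1) (a (r+M)) (haV _) _ (hl (r+1))
    simp only [hh]
    simp only [cross_sub_r] at e1 e2 e3 e4 ⊢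
    linarith
  have hhM : ∀ r, h (r+M) = h r := by
    intro r
    simp only [hh]
    rw [huM, haMM, cross_neg_l, cross_sub_r, cross_sub_r]; ring
  set Y : ℕ → ℝ × ℝ := fun r => (h r)⁻¹ • uu (θ r) with hYd
  have hYM : ∀ r, Y (r+M) = - Y r := by
    intro r; simp only [hYd]; rw [hhM, huM, smul_neg]
  have hY1 : ∀ r, cross (Y r) (a (r+M) - a r) = -1 := by
    intro r
    have e : cross (uu (θ r)) (a (r+M) - a r) = - h r := by
      simp only [hh]; rw [cross_sub_r, cross_sub_r]; ring
    simp only [hYd]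
    rw [cross_smul_l, e]
    field_simp [(hhpos r).ne']
  have hY2 : ∀ r, cross (Y (r+1)) (a (r+M) - a r) = -1 := by
    intro r
    have e : cross (uu (θ (r+1))) (a (r+M) - a r) = - h (r+1) := by
      rw [hsucc, cross_sub_r, cross_sub_r]; ring
    simp only [hYd]
    rw [cross_smul_l, e]
    field_simp [(hhpos (r+1)).ne']
  have hYY : ∀ r, cross (Y r) (Y (r+1)) < 0 := by
    intro r
    simp only [hYd]
    rw [cross_smul_l, cross_smul_r, cross_uu]
    have : Real.sin (θ r - θ (r+1)) < 0 := Real.sin_neg_of_neg_of_neg_pi_lt (by linarith [hlt r])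
      (by linarith [hpi r])
    have := inv_pos.2 (hhpos r)
    have := inv_pos.2 (hhpos (r+1))
    have := mul_pos ‹0 < (h r)⁻¹› this
    nlinarith
  refine ⟨⟨M, hM, a, fun r => - cross (Y r) (Y (r+1)) / 2, Y, haV, ha2, fun r => by linarith [hYY r],
    ?_, hYM, ?_, hY1, ?_, ?_⟩⟩
  · intro r
    have : r + M + 1 = r + 1 + M := by ring
    rw [this, hYM, hYM]
    simp [cross]
  · intro r
    have e1 := hY1 r
    have e2 := hY2 r
    have e0 := hYY r
    set w := a (r+M) - a r
    simp only [cross] at *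
    set y := Y r
    set y' := Y (r+1)
    ext
    · simp only [Prod.fst_sub, Prod.smul_fst, smul_eq_mul]
      linear_combination y'.1 * e1 - y.1 * e2
    · simp only [Prod.snd_sub, Prod.smul_snd, smul_eq_mul]
      linear_combination y'.2 * e1 - y.2 * e2
  · intro r q hq
    have e := hclosed r q hq _ (hl r)
    rcases e.lt_or_eq with e | e
    · left
      simp only [hYd]; rw [cross_smul_l]
      exact mul_neg_of_pos_of_neg (inv_pos.2 (hhpos r)) e
    · right
      obtain ⟨c, hc⟩ := cross_uu_zero e
      refine ⟨c * h r, ?_, ?_⟩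
      · by_cases hne : q = a r
        · have : c = 0 := by
            rw [hne, sub_self] at hc
            exact (smul_eq_zero.1 hc.symm).resolve_right (huu0 _)
          rw [this, zero_mul]
        · have e3 := hmids r q hq hne
          rw [hc, cross_smul_r, cross_uu] at e3
          have : 0 < Real.sin (mid r - θ r) := Real.sin_pos_of_pos_of_lt_pi (by linarith [mid1 r])
            (by linarith [mid2 r, hpi r])
          have : c < 0 := by by_contra hcon; push Not at hcon; nlinarith
          nlinarith [hhpos r]
      · simp only [hYd]; rw [smul_smul, hc]; congr 1; field_simp [(hhpos r).ne']
  · intro r q hq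
    have e := hclosed r q hq _ (hr r)
    rcases e.lt_or_eq with e | e
    · left
      simp only [hYd]; rw [cross_smul_l]
      exact mul_neg_of_pos_of_neg (inv_pos.2 (hhpos _)) e
    · right
      obtain ⟨c, hc⟩ := cross_uu_zero e
      refine ⟨c * h (r+1), ?_, ?_⟩
      · by_cases hne : q = a r
        · have : c = 0 := by
            rw [hne, sub_self] at hc
            exact (smul_eq_zero.1 hc.symm).resolve_right (huu0 _)
          rw [this, zero_mul]
        · have e3 := hmids r q hq hne
          rw [hc, cross_smul_r, cross_uu] at e3
          have : Real.sin (mid r - θ (r+1)) < 0 := Real.sin_neg_of_neg_of_neg_pi_lt (by linarith [mid2 r])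
            (by linarith [mid1 r, hpi r])
          have : 0 < c := by by_contra hcon; push Not at hcon; nlinarith
          nlinarith [hhpos (r+1)]
      · simp only [hYd]; rw [smul_smul, hc]; congr 1; field_simp [(hhpos _).ne']

end OB

namespace OB

lemma sim_approx (M : ℕ) (t : ℕ → ℝ) (ht : ∀ r, 0 < t r) (e : ℝ) (he : 0 < e) (C : ℕ) :
    ∃ c : ℕ, C ≤ c ∧ ∃ n : ℕ → ℕ, ∀ r < M, 1 ≤ n r ∧ |(n r : ℝ) - c * t r| ≤ e := by
  set f : ℕ → (Fin M → ℝ) := fun k r => Int.fract ((k:ℝ) * t r) with hf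
  have hcomp : IsCompact (Set.univ.pi fun _ : Fin M => Set.Icc (0:ℝ) 1) :=
    isCompact_univ_pi fun _ => isCompact_Icc
  have hmem : ∀ k, f k ∈ (Set.univ.pi fun _ : Fin M => Set.Icc (0:ℝ) 1) := by
    intro k r _
    exact ⟨Int.fract_nonneg _, (Int.fract_lt_one _).le⟩
  obtain ⟨y, _, φ, hφ, hlim⟩ := hcomp.tendsto_subseq hmem
  obtain ⟨N, hN⟩ := Metric.cauchySeq_iff.1 hlim.cauchySeq e he
  obtain ⟨B, hB⟩ : ∃ B : ℕ, ∀ r < M, (1 + e) / t r ≤ B := by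
    obtain ⟨B, hB⟩ := exists_nat_ge (∑ r ∈ Finset.range M, (1 + e) / t r)
    refine ⟨B, fun r hr => le_trans ?_ hB⟩
    exact Finset.single_le_sum (f := fun r => (1+e)/t r)
      (fun r _ => (div_pos (by linarith) (ht r)).le) (Finset.mem_range.2 hr)
  set j := N + φ N + C + B with hj
  have hφj : j ≤ φ j := hφ.id_le j
  refine ⟨φ j - φ N, by omega, fun r => (⌊(φ j : ℝ) * t r⌋ - ⌊(φ N : ℝ) * t r⌋).toNat, fun r hr => ?_⟩
  have hd := hN j (by omega) N le_rfl
  have hd' := (dist_le_pi_dist (f (φ j)) (f (φ N)) ⟨r, hr⟩).trans hd.le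
  rw [Real.dist_eq] at hd'
  simp only [hf] at hd'
  have e1 := Int.self_sub_floor ((φ j : ℝ) * t r)
  have e2 := Int.self_sub_floor ((φ N : ℝ) * t r)
  set F1 := ⌊(φ j : ℝ) * t r⌋
  set F2 := ⌊(φ N : ℝ) * t r⌋
  rw [← e1, ← e2] at hd'
  have hcast : ((φ j - φ N : ℕ) : ℝ) = (φ j : ℝ) - φ N := by
    rw [Nat.cast_sub]; omega
  have hBc : (B : ℝ) ≤ (φ j : ℝ) - φ N := by
    rw [← hcast]; exact_mod_cast (by omega : B ≤ φ j - φ N)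
  have hbig : 1 + e ≤ ((φ j : ℝ) - φ N) * t r := by
    have := (hB r hr).trans hBc
    rwa [div_le_iff₀ (ht r)] at this
  have hab := abs_le.1 hd'
  have hge : (1:ℝ) ≤ ((F1 - F2 : ℤ) : ℝ) := by
    push_cast; linarith [hab.2]
  have hge' : 1 ≤ F1 - F2 := by exact_mod_cast hge
  have hc2 : (((F1 - F2).toNat : ℕ) : ℝ) = (F1 : ℝ) - F2 := by
    have : (((F1 - F2).toNat : ℕ) : ℤ) = F1 - F2 := Int.toNat_of_nonneg (by omega)
    have h2 : ((((F1 - F2).toNat : ℕ) : ℤ) : ℝ) = ((F1 - F2 : ℤ) : ℝ) := by rw [this]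
    push_cast at h2; simpa using h2
  refine ⟨by show 1 ≤ (F1 - F2).toNat; omega, ?_⟩
  rw [hc2, hcast, abs_le]
  constructor <;> linarith [hab.1, hab.2]

lemma affine_ge {α β e j N : ℝ} (h0 : e ≤ α) (hN : e ≤ α + N * β) (hj : 0 ≤ j) (hjN : j ≤ N) :
    e ≤ α + j * β := by
  rcases le_total 0 β with h | h <;> nlinarith

lemma est (Y W w z : ℝ × ℝ) (c η K1 : ℝ) (hW : |cross W w| ≤ η) (hz : |cross z w| ≤ K1)
    (h : c * cross Y w ≤ -K1 ∨ ∃ s : ℝ, w = s • Y ∧ s * cross Y z ≤ 0) :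
    -η ≤ - cross (c • Y + W) w + cross z w := by
  have h1 := abs_le.1 hW
  have h2 := abs_le.1 hz
  rw [cross_add_l, cross_smul_l]
  rcases h with h | ⟨s, rfl, h⟩
  · linarith
  · have e1 : cross Y (s • Y) = 0 := by rw [cross_smul_r, cross_self, mul_zero]
    have e2 : cross z (s • Y) = - (s * cross Y z) := by rw [cross_smul_r, cross_swap]; ring
    rw [e1, e2]
    linarith

lemma abs_cross_le (u v : ℝ × ℝ) : |cross u v| ≤ 2 * (‖u‖ * ‖v‖) := by
  have b1 : |u.1| ≤ ‖u‖ := norm_fst_le u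
  have b2 : |u.2| ≤ ‖u‖ := norm_snd_le u
  have c1 : |v.1| ≤ ‖v‖ := norm_fst_le v
  have c2 : |v.2| ≤ ‖v‖ := norm_snd_le v
  have d1 : |u.1 * v.2| ≤ ‖u‖ * ‖v‖ := by
    rw [abs_mul]; exact mul_le_mul b1 c2 (abs_nonneg _) (norm_nonneg _)
  have d2 : |u.2 * v.1| ≤ ‖u‖ * ‖v‖ := by
    rw [abs_mul]; exact mul_le_mul b2 c1 (abs_nonneg _) (norm_nonneg _)
  unfold cross
  exact (abs_sub _ _).trans (by linarith)

lemma exists_chain (V : Finset (ℝ × ℝ)) (S : Dat V) (ε : ℝ) (hε : 0 < ε) (K0 : ℝ) :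
    ∃ l : ℕ, 1 ≤ l ∧ ∃ A Z : ℕ → ℝ × ℝ, (∀ m, A m ∈ V) ∧ (∀ m, A (m + 2*l) = A m) ∧
    (∀ m, Z (m+1) = Z m + (2:ℝ) • (A (m+l) - A m)) ∧ (∀ m, Z (m+l) = - Z m) ∧
    (∀ m, ∀ v ∈ V, ∀ y ∈ V, -ε ≤ cross (A m - Z m - y) (v - A m)) ∧
    (∀ m, ∀ v ∈ V, ∀ y ∈ V, -ε ≤ cross (A m - Z m - (2:ℝ) • A (m+l) + y) (v - A m)) ∧
    (∀ m, cross (Z m) (A (m+l) - A m) ≤ -K0) ∧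
    (∀ m, cross (Z (m+1)) (A (m+1+l) - A m) ≤ -K0) := by
  obtain ⟨M, hM, a, t, Y, haV, ha, ht, htM, hYM, hY, h1, D2, D3⟩ := S
  -- elementary facts
  have haMM : ∀ r, a (r + M + M) = a r := fun r => by rw [← ha r]; congr 1; ring
  have F1 : ∀ r, ∀ q ∈ V, cross (Y r) (q - a r) ≤ 0 := by
    intro r q hq
    rcases D2 r q hq with h | ⟨s, _, h⟩
    · exact h.le
    · rw [h, cross_smul_r, cross_self, mul_zero]
  have F3 : ∀ r, ∀ q ∈ V, cross (Y (r+1)) (q - a r) ≤ 0 := by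
    intro r q hq
    rcases D3 r q hq with h | ⟨s, _, h⟩
    · exact h.le
    · rw [h, cross_smul_r, cross_self, mul_zero]
  have F5 : ∀ r, cross (Y (r+1)) (a (r+M) - a r) = -1 := by
    intro r
    have := hY r
    have e : Y (r+1) = Y r + (2 * t r) • (a (r+M) - a r) := by rw [← this]; abel
    rw [e, cross_add_l, cross_smul_l, cross_self, h1]; ring
  have F2 : ∀ r, ∀ q ∈ V, -1 ≤ cross (Y r) (q - a r) := by
    intro r q hq
    have := F1 (r+M) q hq
    have h := h1 r
    rw [hYM, cross_neg_l] at this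
    rw [cross_sub_r] at *
    linarith
  have F4 : ∀ r, ∀ q ∈ V, -1 ≤ cross (Y (r+1)) (q - a r) := by
    intro r q hq
    have := F3 (r+M) q hq
    have h := F5 r
    have e : r + M + 1 = r + 1 + M := by ring
    rw [e, hYM, cross_neg_l] at this
    rw [cross_sub_r] at *
    linarith
  -- diameter
  obtain ⟨D, hD1, hD⟩ : ∃ D : ℝ, 1 ≤ D ∧ ∀ q ∈ V, ∀ q' ∈ V, ‖q - q'‖ ≤ D := by
    refine ⟨1 + 2 * ∑ q ∈ V, ‖q‖, ?_, ?_⟩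
    · have : 0 ≤ ∑ q ∈ V, ‖q‖ := Finset.sum_nonneg (fun _ _ => norm_nonneg _)
      linarith
    · intro q hq q' hq'
      have e1 := Finset.single_le_sum (f := fun q : ℝ × ℝ => ‖q‖) (fun _ _ => norm_nonneg _) hq
      have e2 := Finset.single_le_sum (f := fun q : ℝ × ℝ => ‖q‖) (fun _ _ => norm_nonneg _) hq'
      have := norm_sub_le q q'
      linarith
  set K1 : ℝ := 6 * D^2 with hK1
  set η : ℝ := min ε 1 with hη
  have hη0 : 0 < η := lt_min hε one_pos
  have hMpos : (0:ℝ) < M := by exact_mod_cast hM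
  set e' : ℝ := η / (2 * M * D^2) with he'
  have he'0 : 0 < e' := by positivity
  -- choice of c
  have hYM2 : ∀ r, Y (r + 2*M) = Y r := by
    intro r
    have : r + 2*M = r + M + M := by ring
    rw [this, hYM, hYM, neg_neg]
  have ev : ∀ x : ℝ, ∀ᶠ c : ℕ in Filter.atTop, (x < 0 → (c:ℝ) * x ≤ -K1) := by
    intro x
    by_cases hx : x < 0
    · obtain ⟨N, hN⟩ := exists_nat_ge (K1 / (-x))
      filter_upwards [Filter.eventually_ge_atTop N] with c hc _
      have : (N:ℝ) ≤ c := by exact_mod_cast hc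
      have h2 := hN.trans this
      rw [div_le_iff₀ (by linarith)] at h2
      linarith
    · exact Filter.Eventually.of_forall (fun c h => absurd h hx)
  have ev1 : ∀ᶠ c : ℕ in Filter.atTop, ∀ r ∈ Finset.range (2*M), ∀ q ∈ V,
      (cross (Y r) (q - a r) < 0 → (c:ℝ) * cross (Y r) (q - a r) ≤ -K1) ∧
      (cross (Y (r+1)) (q - a r) < 0 → (c:ℝ) * cross (Y (r+1)) (q - a r) ≤ -K1) := by
    rw [Filter.eventually_all_finset]
    intro r _
    rw [Filter.eventually_all_finset]
    intro q _
    exact (ev _).and (ev _)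
  obtain ⟨C1, hC1⟩ := Filter.eventually_atTop.1 ev1
  obtain ⟨C2, hC2⟩ := exists_nat_ge (K0 + 1)
  obtain ⟨c, hc, n', hn'⟩ := sim_approx M t ht e' he'0 (max C1 C2)
  have hcK : K0 + 1 ≤ c := hC2.trans (by exact_mod_cast (le_max_right _ _).trans hc)
  have gap0 := hC1 c ((le_max_left _ _).trans hc)
  have gap : ∀ r, ∀ q ∈ V,
      (cross (Y r) (q - a r) < 0 → (c:ℝ) * cross (Y r) (q - a r) ≤ -K1) ∧
      (cross (Y (r+1)) (q - a r) < 0 → (c:ℝ) * cross (Y (r+1)) (q - a r) ≤ -K1) := by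
    intro r q hq
    have := gap0 (r % (2*M)) (Finset.mem_range.2 (Nat.mod_lt _ (by omega))) q hq
    have p1 : a (r % (2*M)) = a r := Function.Periodic.map_mod_nat ha r
    have p2 : Y (r % (2*M)) = Y r := Function.Periodic.map_mod_nat hYM2 r
    have p3 : Y (r % (2*M) + 1) = Y (r + 1) :=
      Function.Periodic.map_mod_nat (f := fun r => Y (r+1)) (fun r => by
        have : r + 2*M + 1 = r + 1 + 2*M := by ring
        simp only [this, hYM2]) r
    rw [p1, p2, p3] at this
    exact this
  set n : ℕ → ℕ := fun r => n' (r % M) with hn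
  have hnM : ∀ r, n (r + M) = n r := by intro r; simp [hn]
  have hn1 : ∀ r, 1 ≤ n r := fun r => (hn' _ (Nat.mod_lt _ (by omega))).1
  have hnt : ∀ r, |(n r : ℝ) - c * t r| ≤ e' := by
    intro r
    have := (hn' (r % M) (Nat.mod_lt _ (by omega))).2
    have p : t (r % M) = t r := Function.Periodic.map_mod_nat htM r
    rw [p] at this
    exact this
  -- blocks
  set τ : ℕ → ℕ := fun r => ∑ i ∈ Finset.range r, n i with hτ
  have hτ1 : ∀ r, τ (r+1) = τ r + n r := fun r => Finset.sum_range_succ _ _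
  have hτ0 : τ 0 = 0 := by simp [hτ]
  have hτmono : StrictMono τ := strictMono_nat_of_lt_succ (fun r => by rw [hτ1]; have := hn1 r; omega)
  set l := τ M with hl
  have hτM : ∀ r, τ (r+M) = τ r + l := by
    intro r
    induction r with
    | zero => simp [hτ0, hl]
    | succ r ih =>
      have : r + 1 + M = r + M + 1 := by ring
      rw [this, hτ1, ih, hτ1, hnM]; ring
  have hlpos : 1 ≤ l := by
    have := hτmono (show 0 < M by omega)
    omega
  have hex : ∀ m, ∃ r, τ r ≤ m ∧ m < τ (r+1) := by
    intro m
    induction m with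
    | zero => exact ⟨0, by simp [hτ0], by rw [hτ1]; have := hn1 0; omega⟩
    | succ m ih =>
      obtain ⟨r, h1, h2⟩ := ih
      by_cases h : m + 1 < τ (r+1)
      · exact ⟨r, by omega, h⟩
      · exact ⟨r+1, by omega, by rw [hτ1 (r+1)]; have := hn1 (r+1); omega⟩
  choose rr hr1 hr2 using hex
  have huniq : ∀ m r, τ r ≤ m → m < τ (r+1) → rr m = r := by
    intro m r h1 h2
    have g1 : rr m < r + 1 := hτmono.lt_iff_lt.1 ((hr1 m).trans_lt h2)
    have g2 : r < rr m + 1 := hτmono.lt_iff_lt.1 (h1.trans_lt (hr2 m))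
    omega
  have hrrl : ∀ m, rr (m + l) = rr m + M := by
    intro m
    apply huniq
    · rw [hτM]; have := hr1 m; omega
    · have : rr m + M + 1 = rr m + 1 + M := by ring
      rw [this, hτM]; have := hr2 m; omega
  set A : ℕ → ℝ × ℝ := fun m => a (rr m) with hA
  have hAl : ∀ m, A (m + l) = a (rr m + M) := by intro m; simp only [hA, hrrl]
  have hA2 : ∀ m, A (m + l + l) = A m := by intro m; simp only [hA, hrrl, haMM]
  have hAper : ∀ m, A (m + 2*l) = A m := fun m => by rw [← hA2 m]; congr 1; ring
  set Z : ℕ → ℝ × ℝ := fun m => ∑ j ∈ Finset.range l, (A j - A (j + l)) +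
    (2:ℝ) • ∑ j ∈ Finset.range m, (A (j+l) - A j) with hZ
  have hZ1 : ∀ m, Z (m+1) = Z m + (2:ℝ) • (A (m+l) - A m) := by
    intro m; simp only [hZ, Finset.sum_range_succ _ m, smul_add]; abel
  have hZl : ∀ m, Z (m + l) = - Z m := by
    intro m
    induction m with
    | zero =>
      have e : ∑ j ∈ Finset.range l, (A j - A (j + l)) = - ∑ j ∈ Finset.range l, (A (j+l) - A j) := by
        rw [← Finset.sum_neg_distrib]; simp
      simp only [hZ, zero_add, Finset.range_zero, Finset.sum_empty, smul_zero, add_zero]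
      rw [e]; module
    | succ m ih =>
      have : m + 1 + l = m + l + 1 := by ring
      rw [this, hZ1, ih, hZ1, hA2]; module
  have hblock : ∀ r j, j ≤ n r → Z (τ r + j) = Z (τ r) + (2 * (j:ℝ)) • (a (r+M) - a r) := by
    intro r j
    induction j with
    | zero => intro _; simp
    | succ j ih =>
      intro hj
      have hrr : rr (τ r + j) = r := huniq _ _ (by omega) (by rw [hτ1]; omega)
      rw [← add_assoc, hZ1, ih (by omega), hAl]
      simp only [hA, hrr]
      push_cast
      module
  set W : ℕ → ℝ × ℝ := fun r => Z (τ r) - (c:ℝ) • Y r with hW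
  have hZW : ∀ r, Z (τ r) = (c:ℝ) • Y r + W r := by intro r; simp [hW]
  have hWs : ∀ r, W (r+1) - W r = (2 * ((n r : ℝ) - c * t r)) • (a (r+M) - a r) := by
    intro r
    have e : Y (r+1) = Y r + (2 * t r) • (a (r+M) - a r) := by rw [← hY r]; abel
    simp only [hW]
    rw [hτ1, hblock r (n r) le_rfl, e]
    module
  have hWn : ∀ r, ‖W (r+1) - W r‖ ≤ 2 * e' * D := by
    intro r
    rw [hWs, norm_smul, Real.norm_eq_abs, abs_mul, abs_two]
    exact mul_le_mul (by linarith [hnt r]) (hD _ (haV _) _ (haV _)) (norm_nonneg _) (by positivity)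
  have hWM : ∀ r, W (r+M) = - W r := by
    intro r
    simp only [hW]; rw [hτM, hZl, hYM]; module
  have hWk : ∀ r k : ℕ, ‖W (r+k) - W r‖ ≤ k * (2 * e' * D) := by
    intro r k
    induction k with
    | zero => simp
    | succ k ih =>
      have : W (r + (k+1)) - W r = (W (r+k+1) - W (r+k)) + (W (r+k) - W r) := by
        rw [← add_assoc]; abel
      rw [this]
      have := norm_add_le (W (r+k+1) - W (r+k)) (W (r+k) - W r)
      have := hWn (r+k)
      push_cast; linarith
  have hWb : ∀ r, ‖W r‖ ≤ M * e' * D := by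
    intro r
    have h := hWk r M
    rw [hWM] at h
    have e : - W r - W r = (-2:ℝ) • W r := by module
    rw [e, norm_smul] at h
    norm_num at h
    linarith
  have hcW : ∀ r, ∀ q ∈ V, ∀ q' ∈ V, |cross (W r) (q - q')| ≤ η := by
    intro r q hq q' hq'
    have h := abs_cross_le (W r) (q - q')
    have h2 : ‖W r‖ * ‖q - q'‖ ≤ M * e' * D * D :=
      mul_le_mul (hWb r) (hD _ hq _ hq') (norm_nonneg _) (by positivity)
    have h3 : 2 * (M * e' * D * D) = η := by
      rw [he']; field_simp
    linarith
  have hcD : ∀ q ∈ V, ∀ q' ∈ V, ∀ v ∈ V, ∀ v' ∈ V, |cross (q - q') (v - v')| ≤ 2 * D^2 := by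
    intro q hq q' hq' v hv v' hv'
    have h := abs_cross_le (q - q') (v - v')
    have h2 : ‖q - q'‖ * ‖v - v'‖ ≤ D * D :=
      mul_le_mul (hD _ hq _ hq') (hD _ hv _ hv') (norm_nonneg _) (by positivity)
    nlinarith
  have hηε : η ≤ ε := min_le_left _ _
  have hη1 : η ≤ 1 := min_le_right _ _
  -- decomposition of an index
  have hdec : ∀ m, ∃ r j, j < n r ∧ m = τ r + j ∧ rr m = r := by
    intro m
    refine ⟨rr m, m - τ (rr m), ?_, ?_, rfl⟩
    · have := hr1 m; have := hr2 m; rw [hτ1] at this; omega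
    · have := hr1 m; omega
  have hlast : ∀ r, Z (τ r) + (2 * ((n r : ℝ) - 1)) • (a (r+M) - a r) =
      (c:ℝ) • Y (r+1) + W (r+1) - (2:ℝ) • (a (r+M) - a r) := by
    intro r
    rw [← hZW, hτ1, hblock r (n r) le_rfl]; module
  refine ⟨l, hlpos, A, Z, fun m => haV _, hAper, hZ1, hZl, ?_, ?_, ?_, ?_⟩
  · intro m q hq y hy
    obtain ⟨r, j, hj, hm, hr⟩ := hdec m
    have hAm : A m = a r := by simp only [hA, hr]
    rw [hAm, hm, hblock r j hj.le]
    have hjn : (j:ℝ) ≤ (n r : ℝ) - 1 := by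
      have : ((j + 1 : ℕ) : ℝ) ≤ n r := by exact_mod_cast hj
      push_cast at this; linarith
    have b1 := hcD y hy (a r) (haV r) q hq (a r) (haV r)
    have b2 := hcD (a (r+M)) (haV _) (a r) (haV r) q hq (a r) (haV r)
    have key := affine_ge (α := - cross (Z (τ r)) (q - a r) - cross (y - a r) (q - a r))
      (β := - 2 * cross (a (r+M) - a r) (q - a r)) (e := -ε) (j := j) (N := (n r : ℝ) - 1)
      (by
        have := est (Y r) (W r) (q - a r) (-(y - a r)) c η K1 (hcW _ _ hq _ (haV _))
          (by rw [cross_neg_l, abs_neg]; nlinarith)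
          (by
            rcases D2 r q hq with h | ⟨s, hs, h⟩
            · left; exact (gap r q hq).1 h
            · right
              refine ⟨s, h, ?_⟩
              have := F1 r y hy
              have e : cross (Y r) (-(y - a r)) = - cross (Y r) (y - a r) := by simp [cross]; ring
              rw [e]; nlinarith)
        rw [← hZW, cross_neg_l] at this
        linarith)
      (by
        have := est (Y (r+1)) (W (r+1)) (q - a r) ((2:ℝ) • (a (r+M) - a r) - (y - a r)) c η K1
          (hcW _ _ hq _ (haV _))
          (by
            rw [cross_sub_l, cross_smul_l]
            have b1 := abs_le.1 b1
            have b2 := abs_le.1 b2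
            rw [abs_le]; constructor <;> linarith)
          (by
            rcases D3 r q hq with h | ⟨s, hs, h⟩
            · left; exact (gap r q hq).2 h
            · right
              refine ⟨s, h, ?_⟩
              have := F4 r y hy
              rw [cross_sub_r, cross_smul_r, F5]; nlinarith)
        have e := congrArg (fun z => cross z (q - a r)) (hlast r)
        simp only [cross_add_l, cross_sub_l, cross_smul_l] at e this ⊢
        linarith)
      (by positivity) hjn
    convert key using 1
    simp [cross]; ring
  · intro m q hq y hy
    obtain ⟨r, j, hj, hm, hr⟩ := hdec m
    have hAm : A m = a r := by simp only [hA, hr]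
    have hAml : A (m+l) = a (r+M) := by rw [hAl, hr]
    rw [hAml, hAm, hm, hblock r j hj.le]
    have hjn : (j:ℝ) ≤ (n r : ℝ) - 1 := by
      have : ((j + 1 : ℕ) : ℝ) ≤ n r := by exact_mod_cast hj
      push_cast at this; linarith
    have b1 := hcD y hy (a r) (haV r) q hq (a r) (haV r)
    have b2 := hcD (a (r+M)) (haV _) (a r) (haV r) q hq (a r) (haV r)
    have key := affine_ge (α := - cross (Z (τ r)) (q - a r) - 2 * cross (a (r+M) - a r) (q - a r)
        + cross (y - a r) (q - a r))
      (β := - 2 * cross (a (r+M) - a r) (q - a r)) (e := -ε) (j := j) (N := (n r : ℝ) - 1)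
      (by
        have := est (Y r) (W r) (q - a r) ((y - a r) - (2:ℝ) • (a (r+M) - a r)) c η K1
          (hcW _ _ hq _ (haV _))
          (by
            rw [cross_sub_l, cross_smul_l]
            have b1 := abs_le.1 b1
            have b2 := abs_le.1 b2
            rw [abs_le]; constructor <;> linarith)
          (by
            rcases D2 r q hq with h | ⟨s, hs, h⟩
            · left; exact (gap r q hq).1 h
            · right
              refine ⟨s, h, ?_⟩
              have := F2 r y hy
              rw [cross_sub_r, cross_smul_r, h1]; nlinarith)
        rw [← hZW, cross_sub_l, cross_smul_l] at this
        linarith)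
      (by
        have := est (Y (r+1)) (W (r+1)) (q - a r) (y - a r) c η K1
          (hcW _ _ hq _ (haV _)) (by nlinarith)
          (by
            rcases D3 r q hq with h | ⟨s, hs, h⟩
            · left; exact (gap r q hq).2 h
            · right
              refine ⟨s, h, ?_⟩
              have := F3 r y hy
              nlinarith)
        have e := congrArg (fun z => cross z (q - a r)) (hlast r)
        simp only [cross_add_l, cross_sub_l, cross_smul_l] at e this ⊢
        linarith)
      (by positivity) hjn
    convert key using 1
    simp [cross]; ring
  · intro m
    obtain ⟨r, j, hj, hm, hr⟩ := hdec m
    have hAm : A m = a r := by simp only [hA, hr]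
    have hAml : A (m+l) = a (r+M) := by rw [hAl, hr]
    rw [hAml, hAm, hm, hblock r j hj.le, hZW, cross_add_l, cross_smul_l, cross_add_l, cross_smul_l,
      cross_self, h1]
    have := (abs_le.1 (hcW r _ (haV (r+M)) _ (haV r))).2
    linarith
  · intro m
    obtain ⟨r, j, hj, hm, hr⟩ := hdec m
    have hAm : A m = a r := by simp only [hA, hr]
    by_cases hjn : j + 1 < n r
    · have hr' : rr (m+1) = r := huniq _ _ (by omega) (by rw [hτ1]; omega)
      have hAml : A (m+1+l) = a (r+M) := by rw [hAl, hr']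
      have : m + 1 = τ r + (j+1) := by omega
      rw [hAml, hAm, this, hblock r (j+1) hjn.le, hZW, cross_add_l, cross_smul_l, cross_add_l,
        cross_smul_l, cross_self, h1]
      have := (abs_le.1 (hcW r _ (haV (r+M)) _ (haV r))).2
      linarith
    · have hm1 : m + 1 = τ (r+1) := by rw [hτ1]; omega
      have hr' : rr (m+1) = r + 1 := huniq _ _ (by omega) (by rw [hτ1 (r+1)]; have := hn1 (r+1); omega)
      have hAml : A (m+1+l) = a (r+1+M) := by rw [hAl, hr']
      rw [hAml, hAm, hm1, hZW, cross_add_l, cross_smul_l]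
      have g1 := (abs_le.1 (hcW (r+1) _ (haV (r+1+M)) _ (haV r))).2
      have g2 := h1 (r+1)
      have g3 := F3 r _ (haV (r+1))
      have g4 : cross (Y (r+1)) (a (r+1+M) - a r) ≤ -1 := by
        rw [cross_sub_r] at *; linarith
      have hc0 : (0:ℝ) ≤ c := by positivity
      nlinarith

end OB

namespace OB

lemma table_norm (V : Finset (ℝ × ℝ)) : ∃ R : ℝ, 0 ≤ R ∧ ∀ y ∈ table V, ‖y‖ ≤ R := by
  refine ⟨∑ q ∈ V, ‖q‖, Finset.sum_nonneg (fun _ _ => norm_nonneg _), fun y hy => ?_⟩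
  have : table V ⊆ Metric.closedBall 0 (∑ q ∈ V, ‖q‖) := by
    refine convexHull_min ?_ (convex_closedBall _ _)
    intro v hv
    rw [mem_closedBall_zero_iff]
    exact Finset.single_le_sum (f := fun q : ℝ × ℝ => ‖q‖) (fun _ _ => norm_nonneg _) hv
  simpa using this hy

lemma bounded_of_margin (V : Finset (ℝ × ℝ)) (hV : V.Nonempty)
    (hint : (interior (table V)).Nonempty)
    (x a : ℕ → ℝ × ℝ) (ha : ∀ n, a n ∈ V) (hx : ∀ n, x (n+1) = (2:ℝ) • a n - x n)
    (δ : ℝ) (hδ : 0 < δ)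
    (hm : ∀ n, ∀ q ∈ V, q ≠ a n → δ < cross (a n - x n) (q - a n)) :
    ∃ R : ℝ, ∀ n, ‖x n‖ ≤ R := by
  obtain ⟨S⟩ := exists_dat V hV hint
  obtain ⟨R0, hR00, hR0⟩ := table_norm V
  set R := max R0 ‖x 0‖ with hR
  have hRn : 0 ≤ R := hR00.trans (le_max_left _ _)
  have hRx : ‖x 0‖ ≤ R := le_max_right _ _
  have hRV : ∀ y ∈ table V, ‖y‖ ≤ R := fun y hy => (hR0 y hy).trans (le_max_left _ _)
  obtain ⟨l, hl, A, Z, hAV, hper, hZ1, hZl, hi, hii, hiii, hiv⟩ :=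
    exists_chain V S δ hδ (16 * R^2 + 1)
  have hAn : ∀ m, ‖A m‖ ≤ R := fun m => hRV _ (mem_table (hAV m))
  have bd : ∀ u v : ℝ × ℝ, ‖u‖ ≤ 4 * R → ‖v‖ ≤ 2 * R → |cross u v| ≤ 16 * R^2 := by
    intro u v hu hv
    have := abs_cross_le u v
    have h2 : ‖u‖ * ‖v‖ ≤ (4*R) * (2*R) := mul_le_mul hu hv (norm_nonneg _) (by positivity)
    nlinarith
  have sb : ∀ u v : ℝ × ℝ, ‖u‖ ≤ R → ‖v‖ ≤ R → ‖u - v‖ ≤ 2 * R := by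
    intro u v hu hv
    have := norm_sub_le u v; linarith
  refine barrier V l hl A Z hAV hper hZ1 hZl δ hi hii x a ha hx hm ?_ ?_ ?_ ?_
  · intro m
    have e : cross (Z m + A (m+l) - x 0) (Z m + (2:ℝ) • A (m+l) - A m - x 0) =
      cross (Z m) (A (m+l) - A m) + cross (A (m+l) - x 0) (A (m+l) - A m) := by
      simp [cross]; ring
    have := (abs_le.1 (bd (A (m+l) - x 0) (A (m+l) - A m) (by linarith [sb _ _ (hAn (m+l)) hRx])
      (sb _ _ (hAn _) (hAn _)))).2
    rw [e]; linarith [hiii m]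
  · intro m
    have e : cross (Z m + (2:ℝ) • A (m+l) - A m - x 0) (Z (m+1) + A (m+1+l) - x 0) =
      cross (Z (m+1)) (A (m+1+l) - A m) + cross (A m - x 0) (A (m+1+l) - A m) := by
      rw [hZ1]
      simp [cross]; ring
    have := (abs_le.1 (bd (A m - x 0) (A (m+1+l) - A m) (by linarith [sb _ _ (hAn m) hRx])
      (sb _ _ (hAn _) (hAn _)))).2
    rw [e]; linarith [hiv m]
  · intro m hmem
    have hy := hRV _ hmem
    have e : Z m = x 0 - (x 0 - Z m) := by abel
    have hz : ‖Z m‖ ≤ 4 * R := by rw [e]; linarith [sb _ _ hRx hy]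
    have := (abs_le.1 (bd (Z m) (A (m+l) - A m) hz (sb _ _ (hAn _) (hAn _)))).1
    linarith [hiii m]
  · intro m hmem
    have hy := hRV _ hmem
    have e : Z m = ((Z m + (2:ℝ) • A (m+l) - x 0) - A (m+l)) + (x 0 - A (m+l)) := by module
    have hz : ‖Z m‖ ≤ 4 * R := by
      rw [e]
      refine (norm_add_le _ _).trans ?_
      linarith [sb _ _ hy (hAn (m+l)), sb _ _ hRx (hAn (m+l))]
    have := (abs_le.1 (bd (Z m) (A (m+l) - A m) hz (sb _ _ (hAn _) (hAn _)))).1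
    linarith [hiii m]

lemma tang_iff (V : Finset (ℝ × ℝ)) (x p : ℝ × ℝ) :
    tangVert V x p ↔ p ∈ V ∧ ∀ q ∈ V, q ≠ p → 0 < cross (p - x) (q - p) := by
  have key : ∀ q, cross (p - x) (q - x) = cross (p - x) (q - p) := by
    intro q; simp [cross]; ring
  unfold tangVert
  simp only [key]
  refine ⟨fun h => ⟨h.1, fun q hq => h.2 q (mem_table hq)⟩, fun h => ⟨h.1, fun q hq hne => ?_⟩⟩
  have hc : Convex ℝ {q : ℝ × ℝ | q = p ∨ 0 < cross (p - x) (q - p)} := by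
    have e0 : ∀ q : ℝ × ℝ, q = p → cross (p - x) (q - p) = 0 := by
      rintro q rfl; simp [cross]
    intro y1 h1 y2 h2 a b ha hb hab
    simp only [Set.mem_ofPred_eq] at *
    have hsum : cross (p - x) (a • y1 + b • y2 - p) =
        a * cross (p - x) (y1 - p) + b * cross (p - x) (y2 - p) := by
      obtain rfl : b = 1 - a := by linarith
      simp [cross]; ring
    rw [hsum]
    rcases ha.eq_or_lt with rfl | ha'
    · obtain rfl : b = 1 := by linarith
      simpa using h2
    rcases hb.eq_or_lt with rfl | hb'
    · obtain rfl : a = 1 := by linarith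
      simpa using h1
    rcases h1 with h1 | h1
    · rcases h2 with h2 | h2
      · left; rw [h1, h2, ← add_smul, hab, one_smul]
      · right; rw [e0 y1 h1]; nlinarith
    · right
      have : 0 ≤ cross (p - x) (y2 - p) := by
        rcases h2 with h2 | h2
        · rw [e0 y2 h2]
        · exact h2.le
      nlinarith
  have hsub : table V ⊆ {q : ℝ × ℝ | q = p ∨ 0 < cross (p - x) (q - p)} := by
    refine convexHull_min (fun v hv => ?_) hc
    by_cases hvp : v = p
    · exact Or.inl hvp
    · exact Or.inr (h.2 v hv hvp)
  exact (hsub hq).resolve_left hne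

lemma tang_not_table {V : Finset (ℝ × ℝ)} (hV : 3 ≤ V.card) {x p : ℝ × ℝ} (h : tangVert V x p) :
    x ∉ table V := by
  intro hx
  by_cases hxp : x = p
  · obtain ⟨q, hq, hne⟩ := Finset.exists_mem_ne (show 1 < V.card by omega) p
    have := h.2 q (mem_table hq) hne
    rw [hxp] at this
    simp [cross] at this
  · have := h.2 x hx hxp
    simp [cross] at this

lemma mem_dom_iff {V : Finset (ℝ × ℝ)} (hV : 3 ≤ V.card) (x : ℝ × ℝ) :
    x ∈ dom V ↔ ∃ p, tangVert V x p :=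
  ⟨fun h => h.2, fun ⟨p, h⟩ => ⟨tang_not_table hV h, p, h⟩⟩

lemma tang_unique {V : Finset (ℝ × ℝ)} {x p p' : ℝ × ℝ} (h : tangVert V x p)
    (h' : tangVert V x p') : p = p' := by
  by_contra hne
  have h1 := h.2 p' (mem_table h'.1) (Ne.symm hne)
  have h2 := h'.2 p (mem_table h.1) hne
  rw [cross_swap] at h2
  linarith

lemma tang_inj {V : Finset (ℝ × ℝ)} {x x' p p' : ℝ × ℝ} (h : tangVert V x p)
    (h' : tangVert V x' p') (he : (2:ℝ) • p - x = (2:ℝ) • p' - x') : x = x' := by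
  by_cases hne : p = p'
  · subst hne; simpa using he
  · exfalso
    have h1 := ((tang_iff V x p).1 h).2 p' h'.1 (Ne.symm hne)
    have h2 := ((tang_iff V x' p').1 h').2 p h.1 hne
    have e : x' = (2:ℝ) • p' - ((2:ℝ) • p - x) := by rw [he]; abel
    rw [e] at h2
    simp only [cross, Prod.fst_sub, Prod.snd_sub, Prod.smul_fst, Prod.smul_snd, smul_eq_mul] at h1 h2
    linarith

lemma tang_open (V : Finset (ℝ × ℝ)) (p : ℝ × ℝ) : IsOpen {x | tangVert V x p} := by
  by_cases hp : p ∈ V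
  · have : {x | tangVert V x p} = ⋂ q ∈ V, {x | q ≠ p → 0 < cross (p - x) (q - p)} := by
      ext x
      simp only [Set.mem_ofPred_eq, tang_iff, hp, true_and, Set.mem_iInter]
    rw [this]
    refine isOpen_biInter_finset (fun q _ => ?_)
    by_cases hq : q = p
    · simp [hq]
    · simp only [ne_eq, hq, not_false_eq_true, forall_const]
      refine isOpen_lt continuous_const ?_
      unfold cross; fun_prop
  · have : {x | tangVert V x p} = ∅ := by
      ext x; simp only [Set.mem_ofPred_eq, Set.mem_empty_iff_false, iff_false]
      exact fun h => hp h.1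
    rw [this]; exact isOpen_empty

lemma tang_convex (V : Finset (ℝ × ℝ)) (p c : ℝ × ℝ) (s : ℝ) :
    Convex ℝ {x | tangVert V (s • x + c) p} := by
  intro y1 h1 y2 h2 a b ha hb hab
  simp only [Set.mem_ofPred_eq, tang_iff] at *
  refine ⟨h1.1, fun q hq hne => ?_⟩
  have g1 := h1.2 q hq hne
  have g2 := h2.2 q hq hne
  have hsum : cross (p - (s • (a • y1 + b • y2) + c)) (q - p) =
      a * cross (p - (s • y1 + c)) (q - p) + b * cross (p - (s • y2 + c)) (q - p) := by
    obtain rfl : b = 1 - a := by linarith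
    simp [cross]; ring
  rw [hsum]
  rcases ha.eq_or_lt with rfl | ha'
  · obtain rfl : b = 1 := by linarith
    simpa using g2
  · nlinarith [mul_pos ha' g1, mul_nonneg hb g2.le]

/-- points with infinite orbit -/
def GG (V : Finset (ℝ × ℝ)) (T : ℝ × ℝ → ℝ × ℝ) : Set (ℝ × ℝ) := {x | ∀ n, T^[n] x ∈ dom V}

lemma good_eq (V : Finset (ℝ × ℝ)) (T : ℝ × ℝ → ℝ × ℝ) : goodRegion V T = interior (GG V T) := by
  apply Set.Subset.antisymm
  · apply interior_maximal
    · rintro x ⟨h1, h2⟩ n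
      by_contra hn
      exact h2 (subset_closure ⟨h1, n, hn⟩)
    · exact ((table_closed V).isOpen_compl).sdiff isClosed_closure
  · intro x hx
    refine ⟨(interior_subset hx 0).1, fun hcl => ?_⟩
    obtain ⟨y, hy1, hy2⟩ := mem_closure_iff.1 hcl _ isOpen_interior hx
    obtain ⟨n, hn⟩ := hy2.2
    exact hn (interior_subset hy1 n)

lemma tang_const (V : Finset (ℝ × ℝ)) {S : Set (ℝ × ℝ)} (hS : IsPreconnected S)
    (hne : S.Nonempty) (hd : S ⊆ dom V) : ∃ p, ∀ y ∈ S, tangVert V y p := by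
  obtain ⟨y0, hy0⟩ := hne
  obtain ⟨p, hp⟩ := (hd hy0).2
  refine ⟨p, ?_⟩
  have := hS.subset_left_of_subset_union (tang_open V p)
    (v := ⋃ p' ∈ {p' | p' ≠ p}, {x | tangVert V x p'})
    (isOpen_biUnion (fun p' _ => tang_open V p'))
    (by
      rw [Set.disjoint_left]
      intro x hx hx'
      simp only [Set.mem_iUnion] at hx'
      obtain ⟨p', hne, h⟩ := hx'
      exact hne (tang_unique h hx))
    (by
      intro y hy
      obtain ⟨p', hp'⟩ := (hd hy).2
      by_cases h : p' = p
      · left; rw [← h]; exact hp'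
      · right; simp only [Set.mem_iUnion]; exact ⟨p', h, hp'⟩)
    ⟨y0, hy0, hp⟩
  exact this

lemma itin (V : Finset (ℝ × ℝ)) (T : ℝ × ℝ → ℝ × ℝ)
    (hT : ∀ x p : ℝ × ℝ, tangVert V x p → T x = (2 : ℝ) • p - x)
    {S : Set (ℝ × ℝ)} (hS : IsPreconnected S) (hne : S.Nonempty) (hG : S ⊆ GG V T) :
    ∃ p c : ℕ → ℝ × ℝ, ∀ n, ∀ y ∈ S, tangVert V (T^[n] y) (p n) ∧
      T^[n] y = (-1:ℝ)^n • y + c n := by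
  have step : ∀ n c, (∀ y ∈ S, T^[n] y = (-1:ℝ)^n • y + c) →
      ∃ p, ∀ y ∈ S, tangVert V (T^[n] y) p := by
    intro n c h
    have himg : IsPreconnected ((fun y => T^[n] y) '' S) := by
      apply hS.image
      have : ContinuousOn (fun y : ℝ × ℝ => (-1:ℝ)^n • y + c) S := by fun_prop
      exact this.congr (fun y hy => h y hy)
    obtain ⟨p, hp⟩ := tang_const V himg (hne.image _) (by
      rintro _ ⟨y, hy, rfl⟩; exact hG hy n)
    exact ⟨p, fun y hy => hp _ ⟨y, hy, rfl⟩⟩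
  have hc : ∀ n, ∃ c, ∀ y ∈ S, T^[n] y = (-1:ℝ)^n • y + c := by
    intro n
    induction n with
    | zero => exact ⟨0, fun y _ => by simp⟩
    | succ n ih =>
      obtain ⟨c, hc⟩ := ih
      obtain ⟨p, hp⟩ := step n c hc
      refine ⟨(2:ℝ) • p - c, fun y hy => ?_⟩
      rw [Function.iterate_succ_apply', hT _ _ (hp y hy), hc y hy, pow_succ]
      module
  choose c hc using hc
  choose p hp using fun n => step n (c n) (hc n)
  exact ⟨p, c, fun n y hy => ⟨hp n y hy, hc n y hy⟩⟩

lemma GG_iter {V : Finset (ℝ × ℝ)} {T : ℝ × ℝ → ℝ × ℝ} {x : ℝ × ℝ} (h : x ∈ GG V T) (n : ℕ) :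
    T^[n] x ∈ GG V T := by
  intro k
  rw [← Function.iterate_add_apply]; exact h _

lemma T_inj {V : Finset (ℝ × ℝ)} {T : ℝ × ℝ → ℝ × ℝ}
    (hT : ∀ x p : ℝ × ℝ, tangVert V x p → T x = (2 : ℝ) • p - x) {x y : ℝ × ℝ}
    (hx : x ∈ GG V T) (hy : y ∈ GG V T) (h : T x = T y) : x = y := by
  obtain ⟨p, hp⟩ := (hx 0).2
  obtain ⟨p', hp'⟩ := (hy 0).2
  have hp : tangVert V x p := hp
  have hp' : tangVert V y p' := hp'
  rw [hT _ _ hp, hT _ _ hp'] at h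
  exact tang_inj hp hp' h

lemma iter_inj {V : Finset (ℝ × ℝ)} {T : ℝ × ℝ → ℝ × ℝ}
    (hT : ∀ x p : ℝ × ℝ, tangVert V x p → T x = (2 : ℝ) • p - x) (n : ℕ) {x y : ℝ × ℝ}
    (hx : x ∈ GG V T) (hy : y ∈ GG V T) (h : T^[n] x = T^[n] y) : x = y := by
  induction n with
  | zero => simpa using h
  | succ n ih =>
    rw [Function.iterate_succ_apply', Function.iterate_succ_apply'] at h
    exact ih (T_inj hT (GG_iter hx n) (GG_iter hy n) h)

lemma affine_image_open (s : ℝ) (hs : s ≠ 0) (c : ℝ × ℝ) {S : Set (ℝ × ℝ)} (hS : IsOpen S) :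
    IsOpen ((fun y : ℝ × ℝ => s • y + c) '' S) := by
  have h1 : IsOpenMap (fun y : ℝ × ℝ => s • y) := isOpenMap_smul₀ hs
  have h2 : IsOpenMap (fun y : ℝ × ℝ => y + c) := isOpenMap_add_right c
  exact (h2.comp h1) S hS

lemma iter_image (V : Finset (ℝ × ℝ)) (T : ℝ × ℝ → ℝ × ℝ)
    (hT : ∀ x p : ℝ × ℝ, tangVert V x p → T x = (2 : ℝ) • p - x)
    {S : Set (ℝ × ℝ)} (hS : IsPreconnected S) (hSo : IsOpen S) (hG : S ⊆ goodRegion V T)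
    (n : ℕ) {x : ℝ × ℝ} (hx : x ∈ S) :
    ∀ y ∈ S, T^[n] y ∈ connectedComponentIn (goodRegion V T) (T^[n] x) := by
  have hG' : S ⊆ GG V T := by
    rw [good_eq] at hG; exact hG.trans interior_subset
  obtain ⟨p, c, h⟩ := itin V T hT hS ⟨x, hx⟩ hG'
  have e : (fun y => T^[n] y) '' S = (fun y : ℝ × ℝ => (-1:ℝ)^n • y + c n) '' S :=
    Set.image_congr (fun y hy => (h n y hy).2)
  have ho : IsOpen ((fun y => T^[n] y) '' S) := by
    rw [e]; exact affine_image_open _ (by simp) _ hSo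
  have hp : IsPreconnected ((fun y => T^[n] y) '' S) := by
    rw [e]; exact hS.image _ (by fun_prop)
  have hsub : (fun y => T^[n] y) '' S ⊆ goodRegion V T := by
    rw [good_eq]
    refine interior_maximal ?_ ho
    rintro _ ⟨y, hy, rfl⟩; exact GG_iter (hG' hy) n
  have := hp.subset_connectedComponentIn (Set.mem_image_of_mem _ hx) hsub
  intro y hy
  exact this ⟨y, hy, rfl⟩

lemma good_open (V : Finset (ℝ × ℝ)) (T : ℝ × ℝ → ℝ × ℝ) : IsOpen (goodRegion V T) := by
  rw [good_eq]; exact isOpen_interior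

lemma good_sub (V : Finset (ℝ × ℝ)) (T : ℝ × ℝ → ℝ × ℝ) : goodRegion V T ⊆ GG V T := by
  rw [good_eq]; exact interior_subset

lemma comp_open (V : Finset (ℝ × ℝ)) (T : ℝ × ℝ → ℝ × ℝ) (x : ℝ × ℝ) :
    IsOpen (connectedComponentIn (goodRegion V T) x) := (good_open V T).connectedComponentIn

lemma comp_iter (V : Finset (ℝ × ℝ)) (T : ℝ × ℝ → ℝ × ℝ)
    (hT : ∀ x p : ℝ × ℝ, tangVert V x p → T x = (2 : ℝ) • p - x)
    {x : ℝ × ℝ} (hx : x ∈ goodRegion V T) (n : ℕ) :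
    ∀ y ∈ connectedComponentIn (goodRegion V T) x,
      T^[n] y ∈ connectedComponentIn (goodRegion V T) (T^[n] x) :=
  iter_image V T hT isPreconnected_connectedComponentIn (comp_open V T x)
    (connectedComponentIn_subset _ _) n (mem_connectedComponentIn hx)

lemma good_iter (V : Finset (ℝ × ℝ)) (T : ℝ × ℝ → ℝ × ℝ)
    (hT : ∀ x p : ℝ × ℝ, tangVert V x p → T x = (2 : ℝ) • p - x)
    {x : ℝ × ℝ} (hx : x ∈ goodRegion V T) (n : ℕ) : T^[n] x ∈ goodRegion V T :=
  connectedComponentIn_subset _ _ (comp_iter V T hT hx n x (mem_connectedComponentIn hx))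

lemma comp_convex (V : Finset (ℝ × ℝ)) (hV : 3 ≤ V.card) (T : ℝ × ℝ → ℝ × ℝ)
    (hT : ∀ x p : ℝ × ℝ, tangVert V x p → T x = (2 : ℝ) • p - x)
    {x : ℝ × ℝ} (hx : x ∈ goodRegion V T) :
    Convex ℝ (connectedComponentIn (goodRegion V T) x) := by
  set C := connectedComponentIn (goodRegion V T) x with hC
  have hxC : x ∈ C := mem_connectedComponentIn hx
  have hCG : C ⊆ goodRegion V T := connectedComponentIn_subset _ _
  obtain ⟨p, c, h⟩ := itin V T hT (isPreconnected_connectedComponentIn) ⟨x, hxC⟩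
    (hCG.trans (good_sub V T))
  have hrec : ∀ n, c (n+1) = (2:ℝ) • p n - c n := by
    intro n
    have h1 := (h (n+1) x hxC).2
    rw [Function.iterate_succ_apply', hT _ _ (h n x hxC).1, (h n x hxC).2, pow_succ] at h1
    have : c (n+1) = ((-1:ℝ)^n * -1) • x + c (n+1) + (-1:ℝ)^n • x := by module
    rw [this, ← h1]; module
  have hO : convexHull ℝ C ⊆ goodRegion V T := by
    rw [good_eq]
    refine interior_maximal ?_ (comp_open V T x).convexHull
    intro y hy
    have ht : ∀ n, tangVert V ((-1:ℝ)^n • y + c n) (p n) := by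
      intro n
      refine convexHull_min ?_ (tang_convex V (p n) (c n) ((-1:ℝ)^n)) hy
      intro z hz
      have := (h n z hz).1
      rw [(h n z hz).2] at this
      exact this
    have hit : ∀ n, T^[n] y = (-1:ℝ)^n • y + c n := by
      intro n
      induction n with
      | zero =>
        have := (h 0 x hxC).2
        simp at this
        simp [this]
      | succ n ih =>
        rw [Function.iterate_succ_apply', ih, hT _ _ (ht n), hrec, pow_succ]; module
    intro n
    rw [mem_dom_iff hV, hit]
    exact ⟨_, ht n⟩
  have hsub : convexHull ℝ C ⊆ C :=
    (convex_convexHull ℝ C).isPreconnected.subset_connectedComponentIn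
      (subset_convexHull ℝ C hxC) hO
  have := convex_convexHull ℝ C
  rwa [hsub.antisymm (subset_convexHull ℝ C)] at this

end OB

namespace OB

lemma min_dist (V : Finset (ℝ × ℝ)) : ∃ μ : ℝ, 0 < μ ∧ ∀ q ∈ V, ∀ q' ∈ V, q ≠ q' → μ ≤ ‖q - q'‖ := by
  classical
  by_cases h : V.offDiag.Nonempty
  · obtain ⟨z, hz, hmin⟩ := V.offDiag.exists_min_image (fun z => ‖z.1 - z.2‖) h
    refine ⟨‖z.1 - z.2‖, norm_pos_iff.2 (sub_ne_zero.2 (Finset.mem_offDiag.1 hz).2.2), ?_⟩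
    intro q hq q' hq' hne
    exact hmin (q, q') (Finset.mem_offDiag.2 ⟨hq, hq', hne⟩)
  · refine ⟨1, one_pos, fun q hq q' hq' hne => ?_⟩
    exact absurd ⟨(q, q'), Finset.mem_offDiag.2 ⟨hq, hq', hne⟩⟩ h

lemma orbit_bounded (V : Finset (ℝ × ℝ)) (hV : 3 ≤ V.card)
    (hint : (interior (table V)).Nonempty) (T : ℝ × ℝ → ℝ × ℝ)
    (hT : ∀ x p : ℝ × ℝ, tangVert V x p → T x = (2 : ℝ) • p - x)
    {x : ℝ × ℝ} {δ : ℝ} (hδ : 0 < δ) (hb : Metric.ball x δ ⊆ goodRegion V T) :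
    (∃ R : ℝ, ∀ n, ‖T^[n] x‖ ≤ R) ∧ ∀ n, Metric.ball (T^[n] x) δ ⊆ goodRegion V T := by
  have hx : x ∈ Metric.ball x δ := Metric.mem_ball_self hδ
  have hpre : IsPreconnected (Metric.ball x δ) := (convex_ball x δ).isPreconnected
  obtain ⟨p, c, h⟩ := itin V T hT hpre ⟨x, hx⟩ (hb.trans (good_sub V T))
  have habs : ∀ n : ℕ, |(-1:ℝ)^n| = 1 := by intro n; simp
  have hsq : ∀ n : ℕ, (-1:ℝ)^n * (-1:ℝ)^n = 1 := by
    intro n; rw [← mul_pow]; simp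
  have hrep : ∀ n, ∀ z ∈ Metric.ball (T^[n] x) δ, ∃ y ∈ Metric.ball x δ, T^[n] y = z := by
    intro n z hz
    have hmem : x + (-1:ℝ)^n • (z - T^[n] x) ∈ Metric.ball x δ := by
      rw [mem_ball_iff_norm] at hz ⊢
      rw [add_sub_cancel_left, norm_smul, Real.norm_eq_abs, habs, one_mul]; exact hz
    refine ⟨_, hmem, ?_⟩
    rw [(h n _ hmem).2, smul_add, smul_smul, hsq, one_smul]
    have := (h n x hx).2
    rw [this]; abel
  refine ⟨?_, ?_⟩
  · obtain ⟨μ, hμ, hmin⟩ := min_dist V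
    have hVne : V.Nonempty := Finset.card_pos.1 (by omega)
    refine bounded_of_margin V hVne hint (fun n => T^[n] x) p (fun n => (h n x hx).1.1) ?_
      (δ * μ / 4) (by positivity) ?_
    · intro n
      rw [Function.iterate_succ_apply', hT _ _ (h n x hx).1]
    · intro n q hq hne
      set e := q - p n with he
      have hpV := (h n x hx).1.1
      have hen : μ ≤ ‖e‖ := hmin q hq _ hpV hne
      have he0 : 0 < ‖e‖ := hμ.trans_le hen
      set s : ℝ := δ / (2 * ‖e‖) with hs
      have hs0 : 0 < s := by positivity
      have hnorm : ‖((e.2, -e.1) : ℝ × ℝ)‖ = ‖e‖ := by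
        simp [Prod.norm_def, max_comm]
      have hz : T^[n] x + s • ((e.2, -e.1) : ℝ × ℝ) ∈ Metric.ball (T^[n] x) δ := by
        rw [mem_ball_iff_norm, add_sub_cancel_left, norm_smul, hnorm, Real.norm_eq_abs, abs_of_pos hs0,
          hs]
        have : δ / (2 * ‖e‖) * ‖e‖ = δ / 2 := by field_simp
        rw [this]; linarith
      obtain ⟨y, hy, hyz⟩ := hrep n _ hz
      have ht := (h n y hy).1
      rw [hyz] at ht
      have hpos := ((tang_iff _ _ _).1 ht).2 q hq hne
      rw [← he] at hpos
      have e1 : cross (p n - (T^[n] x + s • ((e.2, -e.1) : ℝ × ℝ))) e =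
        cross (p n - T^[n] x) e - s * (e.1^2 + e.2^2) := by
        simp [cross]; ring
      rw [e1] at hpos
      have f : ‖e‖ ^ 2 ≤ e.1^2 + e.2^2 := by
        rw [Prod.norm_def]
        rcases max_choice ‖e.1‖ ‖e.2‖ with h | h <;> rw [h, Real.norm_eq_abs, sq_abs]
        · nlinarith [sq_nonneg e.2]
        · nlinarith [sq_nonneg e.1]
      have g1 : s * ‖e‖^2 ≤ s * (e.1^2 + e.2^2) := mul_le_mul_of_nonneg_left f hs0.le
      have g2 : s * ‖e‖^2 = δ * ‖e‖ / 2 := by rw [hs]; field_simp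
      have g3 : δ * μ ≤ δ * ‖e‖ := mul_le_mul_of_nonneg_left hen hδ.le
      have g4 : 0 < δ * μ := by positivity
      linarith
  · intro n z hz
    obtain ⟨y, hy, rfl⟩ := hrep n z hz
    exact good_iter V T hT (hb hy) n

lemma periodic (V : Finset (ℝ × ℝ)) (hV : 3 ≤ V.card)
    (hint : (interior (table V)).Nonempty) (T : ℝ × ℝ → ℝ × ℝ)
    (hT : ∀ x p : ℝ × ℝ, tangVert V x p → T x = (2 : ℝ) • p - x)
    {x : ℝ × ℝ} (hx : x ∈ goodRegion V T) :
    ∃ k : ℕ, 1 ≤ k ∧ ∀ y ∈ connectedComponentIn (goodRegion V T) x, T^[2*k] y = y := by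
  obtain ⟨δ, hδ, hb⟩ := Metric.isOpen_iff.1 (good_open V T) x hx
  obtain ⟨⟨R, hR⟩, hball⟩ := orbit_bounded V hV hint T hT hδ hb
  obtain ⟨z, _, φ, hφ, hlim⟩ := tendsto_subseq_of_bounded (Metric.isBounded_closedBall (x := 0) (r := R))
    (x := fun n => T^[n] x) (fun n => by simpa using hR n)
  obtain ⟨N, hN⟩ := Metric.cauchySeq_iff.1 hlim.cauchySeq δ hδ
  have hlt : φ N < φ (N+1) := hφ (Nat.lt_succ_self N)
  have hd := hN (N+1) (by omega) N le_rfl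
  simp only [Function.comp] at hd
  set i := φ N with hi
  obtain ⟨k, hk, hk1⟩ : ∃ k, φ (N+1) = k + i ∧ 1 ≤ k := ⟨φ (N+1) - i, by omega, by omega⟩
  rw [hk] at hd
  have hxi := good_iter V T hT hx i
  set xi := T^[i] x with hxid
  set Ci := connectedComponentIn (goodRegion V T) xi with hCi
  have hk' : T^[k + i] x = T^[k] xi := Function.iterate_add_apply _ _ _ _
  rw [hk'] at hd
  have hin : T^[k] xi ∈ Ci :=
    (convex_ball xi δ).isPreconnected.subset_connectedComponentIn (Metric.mem_ball_self hδ)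
      (hball i) (Metric.mem_ball.2 hd)
  have hself : ∀ y ∈ Ci, T^[k] y ∈ Ci := by
    intro y hy
    have := comp_iter V T hT hxi k y hy
    rwa [← connectedComponentIn_eq hin] at this
  have hxiC : xi ∈ Ci := mem_connectedComponentIn hxi
  have hself2 : ∀ y ∈ Ci, T^[2*k] y ∈ Ci := by
    intro y hy
    rw [two_mul, Function.iterate_add_apply]
    exact hself _ (hself y hy)
  obtain ⟨p, c, h⟩ := itin V T hT (isPreconnected_connectedComponentIn) ⟨xi, hxiC⟩
    ((connectedComponentIn_subset _ _).trans (good_sub V T))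
  have htr : ∀ y ∈ Ci, T^[2*k] y = y + c (2*k) := by
    intro y hy
    rw [(h (2*k) y hy).2, pow_mul]; simp
  have hmult : ∀ n : ℕ, T^[2*k*n] xi ∈ Ci ∧ T^[2*k*n] xi = xi + (n:ℝ) • c (2*k) := by
    intro n
    induction n with
    | zero => simpa using hxiC
    | succ n ih =>
      have : 2*k*(n+1) = 2*k + 2*k*n := by ring
      rw [this, Function.iterate_add_apply]
      refine ⟨hself2 _ ih.1, ?_⟩
      rw [htr _ ih.1, ih.2]; push_cast; module
  have hc0 : c (2*k) = 0 := by
    by_contra hne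
    have hpos : 0 < ‖c (2*k)‖ := norm_pos_iff.2 hne
    obtain ⟨n, hn⟩ := exists_nat_gt (2 * R / ‖c (2*k)‖)
    rw [div_lt_iff₀ hpos] at hn
    have h1 := (hmult n).2
    have h2 : (n:ℝ) • c (2*k) = T^[2*k*n] xi - xi := by rw [h1]; abel
    have h3 : ‖(n:ℝ) • c (2*k)‖ ≤ 2 * R := by
      rw [h2]
      refine (norm_sub_le _ _).trans ?_
      have g1 := hR i
      have g2 : ‖T^[2*k*n] xi‖ ≤ R := by
        rw [hxid, ← Function.iterate_add_apply]; exact hR _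
      linarith
    rw [norm_smul, Real.norm_natCast] at h3
    linarith
  refine ⟨k, hk1, fun y hy => ?_⟩
  have hyG : y ∈ GG V T := good_sub V T (connectedComponentIn_subset _ _ hy)
  apply iter_inj hT i (GG_iter hyG _) hyG
  rw [← Function.iterate_add_apply, add_comm, Function.iterate_add_apply,
    htr _ (comp_iter V T hT hx i y hy), hc0, add_zero]

lemma comp_bounded (V : Finset (ℝ × ℝ)) (hV : 3 ≤ V.card)
    (hint : (interior (table V)).Nonempty) (T : ℝ × ℝ → ℝ × ℝ)
    (hT : ∀ x p : ℝ × ℝ, tangVert V x p → T x = (2 : ℝ) • p - x)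
    {x : ℝ × ℝ} (hx : x ∈ goodRegion V T) :
    Bornology.IsBounded (connectedComponentIn (goodRegion V T) x) := by
  obtain ⟨k, hk1, hk⟩ := periodic V hV hint T hT hx
  set C := connectedComponentIn (goodRegion V T) x with hC
  have hxC : x ∈ C := mem_connectedComponentIn hx
  obtain ⟨p, c, h⟩ := itin V T hT (isPreconnected_connectedComponentIn) ⟨x, hxC⟩
    ((connectedComponentIn_subset _ _).trans (good_sub V T))
  by_contra hunb
  have hex : ∀ N : ℕ, ∃ y ∈ C, (N:ℝ) + 1 ≤ ‖y‖ := by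
    intro N
    by_contra hcon
    push Not at hcon
    apply hunb
    rw [isBounded_iff_forall_norm_le]
    exact ⟨N + 1, fun y hy => (hcon y hy).le⟩
  choose y hyC hyN using hex
  have hypos : ∀ N, 0 < ‖y N‖ := fun N => lt_of_lt_of_le (by positivity) (hyN N)
  obtain ⟨d, hd, φ, hφ, hlim⟩ := (isCompact_sphere (0 : ℝ × ℝ) 1).tendsto_subseq
    (x := fun N => ‖y N‖⁻¹ • y N) (fun N => by
      rw [mem_sphere_zero_iff_norm, norm_smul, norm_inv, norm_norm, inv_mul_cancel₀ (hypos N).ne'])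
  have hd0 : d ≠ 0 := by
    rintro rfl; simp at hd
  have hinv : Filter.Tendsto (fun N => ‖y (φ N)‖⁻¹) Filter.atTop (nhds 0) := by
    apply Filter.Tendsto.inv_tendsto_atTop
    have : Filter.Tendsto (fun N => ‖y N‖) Filter.atTop Filter.atTop := by
      refine Filter.tendsto_atTop_mono (fun N => ?_) tendsto_natCast_atTop_atTop
      have := hyN N
      linarith
    exact this.comp hφ.tendsto_atTop
  have key : ∀ n, ∀ q ∈ V, (-1:ℝ)^n * cross d (q - p n) ≤ 0 := by
    intro n q hq
    by_cases hne : q = p n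
    · rw [hne]; simp [cross]
    have hN : ∀ N, 0 ≤ ‖y (φ N)‖⁻¹ * cross (p n - c n) (q - p n) -
        (-1:ℝ)^n * cross (‖y (φ N)‖⁻¹ • y (φ N)) (q - p n) := by
      intro N
      have ht := h n _ (hyC (φ N))
      have h1 := ((tang_iff _ _ _).1 ht.1).2 q hq hne
      rw [ht.2] at h1
      have h2 := mul_pos (inv_pos.2 (hypos (φ N))) h1
      have e : p n - ((-1:ℝ)^n • y (φ N) + c n) = (p n - c n) - (-1:ℝ)^n • y (φ N) := by abel
      rw [e, cross_sub_l, cross_smul_l] at h2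
      rw [cross_smul_l]
      linarith
    have hl1 : Filter.Tendsto (fun N => ‖y (φ N)‖⁻¹ * cross (p n - c n) (q - p n) -
        (-1:ℝ)^n * cross (‖y (φ N)‖⁻¹ • y (φ N)) (q - p n)) Filter.atTop
        (nhds (0 * cross (p n - c n) (q - p n) - (-1:ℝ)^n * cross d (q - p n))) := by
      refine (hinv.mul_const _).sub (Filter.Tendsto.const_mul _ ?_)
      have hcont : Continuous (fun w => cross w (q - p n)) := by unfold cross; fun_prop
      exact (hcont.tendsto d).comp hlim
    have := ge_of_tendsto' hl1 hN
    linarith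
  have hdec : ∀ n : ℕ, cross d (T^[2*(n+1)] x) < cross d (T^[2*n] x) := by
    intro n
    have e1 : T^[2*(n+1)] x = (2:ℝ) • p (2*n+1) - ((2:ℝ) • p (2*n) - T^[2*n] x) := by
      have : 2*(n+1) = 2*n+1+1 := by ring
      rw [this, Function.iterate_succ_apply', hT _ _ (h (2*n+1) x hxC).1,
        Function.iterate_succ_apply', hT _ _ (h (2*n) x hxC).1]
    have k1 : ∀ q ∈ V, cross d q ≤ cross d (p (2*n)) := by
      intro q hq
      have := key (2*n) q hq
      rw [pow_mul, cross_sub_r] at this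
      norm_num at this; linarith
    have k2 : ∀ q ∈ V, cross d (p (2*n+1)) ≤ cross d q := by
      intro q hq
      have := key (2*n+1) q hq
      rw [pow_succ, pow_mul, cross_sub_r] at this
      norm_num at this; linarith
    have k3 : cross d (p (2*n+1)) < cross d (p (2*n)) := by
      by_contra hcon
      push Not at hcon
      exact not_collinear V hint d hd0 (cross d (p (2*n))) (fun v hv => by
        linarith [k1 v hv, k2 v hv])
    rw [e1, cross_sub_r, cross_sub_r, cross_smul_r, cross_smul_r]
    linarith
  have hanti : StrictAnti (fun n : ℕ => cross d (T^[2*n] x)) := strictAnti_nat_of_succ_lt hdec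
  have := hanti (show 0 < k by omega)
  simp only [hk x hxC] at this
  simp at this

end OB

/-- For the outer billiard map `T` about a convex polygon, each connected component of the
complement of the closure of the set of finite-orbit points is an open bounded convex set,
and `T` maps each such component isometrically onto another such component. -/
theorem components_open_bounded_convex_mapped_isometrically
    (V : Finset (ℝ × ℝ)) (hV : 3 ≤ V.card)
    (hint : (interior (table V)).Nonempty)
    (T : ℝ × ℝ → ℝ × ℝ)
    (hT : ∀ x p : ℝ × ℝ, tangVert V x p → T x = (2 : ℝ) • p - x)
    (x : ℝ × ℝ) (hx : x ∈ goodRegion V T) :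
    IsOpen (connectedComponentIn (goodRegion V T) x) ∧
    Bornology.IsBounded (connectedComponentIn (goodRegion V T) x) ∧
    Convex ℝ (connectedComponentIn (goodRegion V T) x) ∧
    T x ∈ goodRegion V T ∧
    (∀ a ∈ connectedComponentIn (goodRegion V T) x,
      ∀ b ∈ connectedComponentIn (goodRegion V T) x, dist (T a) (T b) = dist a b) ∧
    T '' connectedComponentIn (goodRegion V T) x =
      connectedComponentIn (goodRegion V T) (T x) := by
  have hxC := mem_connectedComponentIn hx
  have hTx : T x ∈ goodRegion V T := OB.good_iter V T hT hx 1
  refine ⟨OB.comp_open V T x, OB.comp_bounded V hV hint T hT hx, OB.comp_convex V hV T hT hx,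
    hTx, ?_, ?_⟩
  · obtain ⟨p, c, h⟩ := OB.itin V T hT (isPreconnected_connectedComponentIn) ⟨x, hxC⟩
      ((connectedComponentIn_subset _ _).trans (OB.good_sub V T))
    intro a ha b hb
    have h1 : tangVert V a (p 0) := (h 0 a ha).1
    have h2 : tangVert V b (p 0) := (h 0 b hb).1
    rw [hT _ _ h1, hT _ _ h2, dist_sub_left]
  · apply Set.Subset.antisymm
    · rintro _ ⟨y, hy, rfl⟩
      exact OB.comp_iter V T hT hx 1 y hy
    · intro y hy
      obtain ⟨k, hk1, hk⟩ := OB.periodic V hV hint T hT hTx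
      obtain ⟨j, hj⟩ : ∃ j, 2 * k = j + 1 := ⟨2 * k - 1, by omega⟩
      have h1 := hk y hy
      rw [hj, Function.iterate_succ_apply'] at h1
      have h2 := OB.comp_iter V T hT hTx j y hy
      have h3 := hk (T x) (mem_connectedComponentIn hTx)
      rw [hj, Function.iterate_succ_apply'] at h3
      have h4 : T^[j] (T x) = x :=
        OB.T_inj hT (OB.good_sub V T (OB.good_iter V T hT hTx j)) (OB.good_sub V T hx) h3
      rw [h4] at h2
      exact ⟨_, h2, h1⟩
end
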